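/- Let D be a measurable space with probability measure ν and let φ₁,…,φ_N : D → ℂ be an orthonormal system in L²(D,ν) with sup_{ξ∈D}|φ_j(ξ)| ≤ K for all j. Let t₁,…,t_m be drawn independently according to ν and form the random matrix A = (1/√m)(φ_j(t_i))_{i=1,…,m, j=1,…,N}. There exists a universal constant c > 0 such that: for any 1 ≤ s ≤ N, 1 ≤ k ≤ m and 0 < δ, ε < 1, if m ≥ c·δ^{−2}·K²·s·(log³(2s)·log(2N) + log(1/ε)) and m ≥ 8·δ^{−2}·K²·s·k, then with probability at least 1 − ε the matrix A has the Restricted Isometry Property for the sparse corruptions problem of order (s,k) with constant δ_{s,k} ≤ δ. -/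

import Mathlib

open Finset Matrix MeasureTheory

noncomputable def l1norm {n : ℕ} (x : Fin n → ℂ) : ℝ := ∑ i, ‖x i‖

noncomputable def l2norm {n : ℕ} (x : Fin n → ℂ) : ℝ := Real.sqrt (∑ i, ‖x i‖ ^ 2)

/-- The vector equal to `x` on `S` and zero elsewhere. -/
def restr {n : ℕ} (x : Fin n → ℂ) (S : Finset (Fin n)) : Fin n → ℂ :=
  fun i => if i ∈ S then x i else 0

/-- `x` has at most `s` nonzero entries. -/
def IsSparse {n : ℕ} (s : ℕ) (x : Fin n → ℂ) : Prop :=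
  ∃ S : Finset (Fin n), S.card ≤ s ∧ ∀ i ∉ S, x i = 0

/-- Best `s`-term approximation error of `x` in the `ℓ¹` norm. -/
noncomputable def sigma1 {n : ℕ} (s : ℕ) (x : Fin n → ℂ) : ℝ :=
  sInf {t : ℝ | ∃ z : Fin n → ℂ, IsSparse s z ∧ t = l1norm (x - z)}

/-- `η_{s,k}(λ) = (s + λ²k)/min{s, λ²k}`. -/
noncomputable def etaSK (s k : ℕ) (lam : ℝ) : ℝ :=
  ((s : ℝ) + lam ^ 2 * k) / min (s : ℝ) (lam ^ 2 * k)

/-- The ℓ¹-robust null space property of order (s,k) with weight lam, constants ρ, τ. -/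
def L1RNSP {m N : ℕ} (A : Matrix (Fin m) (Fin N) ℂ) (s k : ℕ) (lam ρ τ : ℝ) : Prop :=
  ∀ (x : Fin N → ℂ) (c : Fin m → ℂ) (S : Finset (Fin N)) (T : Finset (Fin m)),
    S.card ≤ s → T.card ≤ k →
      l1norm (restr x S) + lam * l1norm (restr c T) ≤
        ρ * (l1norm (restr x Sᶜ) + lam * l1norm (restr c Tᶜ)) + τ * l2norm (A.mulVec x + c)

/-- The ℓ²-robust null space property of order (s,k) with weight lam, constants ρ, τ. -/
def L2RNSP {m N : ℕ} (A : Matrix (Fin m) (Fin N) ℂ) (s k : ℕ) (lam ρ τ : ℝ) : Prop :=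
  ∀ (x : Fin N → ℂ) (c : Fin m → ℂ) (S : Finset (Fin N)) (T : Finset (Fin m)),
    S.card ≤ s → T.card ≤ k →
      Real.sqrt (l2norm (restr x S) ^ 2 + l2norm (restr c T) ^ 2) ≤
        (ρ / Real.sqrt ((s : ℝ) + lam ^ 2 * k)) *
            (l1norm (restr x Sᶜ) + lam * l1norm (restr c Tᶜ)) +
          τ * l2norm (A.mulVec x + c)

/-- `A` satisfies the two-sided RIP inequality for the sparse corruptions problem of
order `(s,k)` with constant `δ`. -/
def RIPCor {m N : ℕ} (A : Matrix (Fin m) (Fin N) ℂ) (s k : ℕ) (δ : ℝ) : Prop :=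
  ∀ (x : Fin N → ℂ) (c : Fin m → ℂ), IsSparse s x → IsSparse k c →
    (1 - δ) * (l2norm x ^ 2 + l2norm c ^ 2) ≤ l2norm (A.mulVec x + c) ^ 2 ∧
      l2norm (A.mulVec x + c) ^ 2 ≤ (1 + δ) * (l2norm x ^ 2 + l2norm c ^ 2)

/-- `A` satisfies the RIP inequality for sparse vectors of order `s` with constant `δ`. -/
def RIPSparse {m N : ℕ} (A : Matrix (Fin m) (Fin N) ℂ) (s : ℕ) (δ : ℝ) : Prop :=
  ∀ x : Fin N → ℂ, IsSparse s x →
    (1 - δ) * l2norm x ^ 2 ≤ l2norm (A.mulVec x) ^ 2 ∧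
      l2norm (A.mulVec x) ^ 2 ≤ (1 + δ) * l2norm x ^ 2

/-- `(xh, ch)` is a minimizer of `‖z‖₁ + lam ‖d‖₁` subject to `‖Az + d - y‖₂ ≤ ε`. -/
def IsMinimizer {m N : ℕ} (A : Matrix (Fin m) (Fin N) ℂ) (y : Fin m → ℂ) (lam ε : ℝ)
    (xh : Fin N → ℂ) (ch : Fin m → ℂ) : Prop :=
  l2norm (A.mulVec xh + ch - y) ≤ ε ∧
    ∀ (z : Fin N → ℂ) (d : Fin m → ℂ), l2norm (A.mulVec z + d - y) ≤ ε →
      l1norm xh + lam * l1norm ch ≤ l1norm z + lam * l1norm d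

/-- Spectral norm of a matrix (operator norm w.r.t. Euclidean norms). -/
noncomputable def specNorm {a b : ℕ} (B : Matrix (Fin a) (Fin b) ℂ) : ℝ :=
  ‖LinearMap.toContinuousLinearMap (Matrix.toEuclideanLin B)‖

/-- `σ_{s,k}(A)`: the maximum spectral norm over `k × s` submatrices of `A`. -/
noncomputable def sigmaSK {m N : ℕ} (A : Matrix (Fin m) (Fin N) ℂ) (s k : ℕ) : ℝ :=
  sSup {t : ℝ | ∃ (S : Finset (Fin N)) (T : Finset (Fin m)) (hS : S.card = s) (hT : T.card = k),
    t = specNorm (A.submatrix (fun i : Fin k => ((T.orderIsoOfFin hT i : Fin m)))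
      (fun j : Fin s => ((S.orderIsoOfFin hS j : Fin N))))}


def rsg (b : Bool) : ℝ := if b then 1 else -1

lemma rsg_sq (b : Bool) : rsg b ^ 2 = 1 := by cases b <;> simp [rsg]

lemma rsg_mgf {ι : Type*} [Fintype ι] [DecidableEq ι] (b : ι → ℝ) :
    ∑ σ : ι → Bool, Real.exp (∑ i, rsg (σ i) * b i) ≤
      2 ^ Fintype.card ι * Real.exp ((∑ i, b i ^ 2) / 2) := by
  have h1 : ∑ σ : ι → Bool, Real.exp (∑ i, rsg (σ i) * b i)
      = ∏ i, ∑ c : Bool, Real.exp (rsg c * b i) := by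
    rw [Finset.prod_univ_sum, Fintype.piFinset_univ]
    simp only [Real.exp_sum]
  rw [h1]
  have h2 : ∀ i, ∑ c : Bool, Real.exp (rsg c * b i) ≤ 2 * Real.exp (b i ^ 2 / 2) := by
    intro i
    have := Real.cosh_le_exp_half_sq (b i)
    rw [Real.cosh_eq] at this
    simp only [Fintype.sum_bool, rsg]
    simp
    linarith
  calc _ ≤ ∏ i, (2 * Real.exp (b i ^ 2 / 2)) :=
        Finset.prod_le_prod (fun i _ => Finset.sum_nonneg fun _ _ => (Real.exp_pos _).le)
          (fun i _ => h2 i)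
    _ = _ := by
        rw [Finset.prod_mul_distrib, ← Real.exp_sum, Finset.sum_div]
        simp

lemma pow_le_fact_exp (x : ℝ) (p : ℕ) :
    x ^ (2 * p) ≤ (2 * p).factorial * (Real.exp x + Real.exp (-x)) := by
  have h : |x| ^ (2 * p) / (2 * p).factorial ≤ Real.exp |x| :=
    Real.pow_div_factorial_le_exp _ (abs_nonneg x) _
  have h2 : Real.exp |x| ≤ Real.exp x + Real.exp (-x) := by
    rcases abs_cases x with ⟨h, _⟩ | ⟨h, _⟩ <;> rw [h]
    · linarith [Real.exp_pos (-x)]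
    · linarith [Real.exp_pos x]
  have h3 : |x| ^ (2 * p) = x ^ (2 * p) := by rw [pow_mul, sq_abs, ← pow_mul]
  rw [h3] at h
  have : (0:ℝ) < (2 * p).factorial := by positivity
  rw [div_le_iff₀ this] at h
  nlinarith

/-- Khintchine inequality, real coefficients. -/
lemma khin_real {ι : Type*} [Fintype ι] [DecidableEq ι] (b : ι → ℝ) (p : ℕ) (hp : 1 ≤ p) :
    ∑ σ : ι → Bool, (∑ i, rsg (σ i) * b i) ^ (2 * p) ≤
      2 ^ Fintype.card ι * ((12 * p) * (∑ i, b i ^ 2)) ^ p := by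
  set B := ∑ i, b i ^ 2 with hB
  have hB0 : 0 ≤ B := Finset.sum_nonneg fun i _ => sq_nonneg _
  rcases hB0.eq_or_lt with h0 | hpos
  · have hz : ∀ i, b i = 0 := by
      intro i
      have := (Finset.sum_eq_zero_iff_of_nonneg (fun i _ => sq_nonneg (b i))).1 h0.symm i
        (Finset.mem_univ i)
      exact pow_eq_zero_iff (two_ne_zero) |>.1 this
    have : p ≠ 0 := by omega
    simp [hz, this, ← h0]
  have hp' : (0:ℝ) < p := by exact_mod_cast hp
  set l := Real.sqrt (2 * p / B) with hl
  have hl2 : l ^ 2 = 2 * p / B := Real.sq_sqrt (by positivity)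
  have hl0 : 0 < l := Real.sqrt_pos.2 (by positivity)
  have key : ∀ σ : ι → Bool, l ^ (2 * p) * (∑ i, rsg (σ i) * b i) ^ (2 * p) ≤
      (2 * p).factorial * (Real.exp (∑ i, rsg (σ i) * (l * b i)) +
        Real.exp (∑ i, rsg (σ i) * (-l * b i))) := by
    intro σ
    have h1 : ∑ i, rsg (σ i) * (l * b i) = l * ∑ i, rsg (σ i) * b i := by
      rw [Finset.mul_sum]; exact Finset.sum_congr rfl fun i _ => by ring
    have h2 : ∑ i, rsg (σ i) * (-l * b i) = - (l * ∑ i, rsg (σ i) * b i) := by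
      rw [Finset.mul_sum, ← Finset.sum_neg_distrib]; exact Finset.sum_congr rfl fun i _ => by ring
    rw [h1, h2, ← mul_pow]
    exact pow_le_fact_exp _ _
  have hs1 := rsg_mgf (fun i => l * b i)
  have hs2 := rsg_mgf (fun i => -l * b i)
  have e1 : (∑ i, (l * b i) ^ 2) / 2 = p := by
    simp only [mul_pow]
    rw [← Finset.mul_sum, ← hB, hl2]; field_simp
  have e2 : (∑ i, (-l * b i) ^ 2) / 2 = p := by
    simp only [mul_pow, neg_sq]
    rw [← Finset.mul_sum, ← hB, hl2]; field_simp
  rw [e1] at hs1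
  rw [e2] at hs2
  have hsum : l ^ (2 * p) * ∑ σ : ι → Bool, (∑ i, rsg (σ i) * b i) ^ (2 * p) ≤
      (2 * p).factorial * (2 * (2 ^ Fintype.card ι * Real.exp p)) := by
    rw [Finset.mul_sum]
    refine (Finset.sum_le_sum fun σ _ => key σ).trans ?_
    rw [← Finset.mul_sum, Finset.sum_add_distrib]
    have : (0:ℝ) ≤ (2 * p).factorial := by positivity
    apply mul_le_mul_of_nonneg_left _ this
    linarith
  have hf : ((2 * p).factorial : ℝ) ≤ (2 * p) ^ (2 * p) := by
    exact_mod_cast Nat.factorial_le_pow (2 * p)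
  have he : Real.exp p ≤ 3 ^ p := by
    rw [← Real.exp_one_pow]
    exact pow_le_pow_left₀ (Real.exp_pos _).le (by linarith [Real.exp_one_lt_three]) _
  have h2p : (2:ℝ) ≤ 2 ^ p := by
    calc (2:ℝ) = 2 ^ 1 := by norm_num
      _ ≤ 2 ^ p := pow_le_pow_right₀ (by norm_num) hp
  have hlp : l ^ (2 * p) = (2 * p / B) ^ p := by rw [pow_mul, hl2]
  rw [hlp] at hsum
  set X := ∑ σ : ι → Bool, (∑ i, rsg (σ i) * b i) ^ (2 * p)
  have hX : X = (B / (2 * p)) ^ p * ((2 * p / B) ^ p * X) := by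
    rw [← mul_assoc, ← mul_pow]
    have : B / (2 * p) * (2 * p / B) = 1 := by field_simp
    rw [this]; simp
  rw [hX]
  calc _ ≤ (B / (2 * p)) ^ p * ((2 * p) ^ (2 * p) * (2 ^ p * (2 ^ Fintype.card ι * 3 ^ p))) := by
        apply mul_le_mul_of_nonneg_left _ (by positivity)
        refine hsum.trans ?_
        gcongr
    _ = _ := by
        rw [pow_mul]
        have : (12 * p * B) = (B / (2 * p)) * ((2 * p) ^ 2) * 2 * 3 := by field_simp; ring
        rw [this]
        simp only [mul_pow]
        ring

/-- Khintchine inequality, complex coefficients. -/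
lemma khin_complex {ι : Type*} [Fintype ι] [DecidableEq ι] (b : ι → ℂ) (p : ℕ) (hp : 1 ≤ p) :
    ∑ σ : ι → Bool, ‖∑ i, (rsg (σ i) : ℂ) * b i‖ ^ (2 * p) ≤
      2 ^ Fintype.card ι * ((24 * p) * (∑ i, ‖b i‖ ^ 2)) ^ p := by
  have h1 := khin_real (fun i => (b i).re) p hp
  have h2 := khin_real (fun i => (b i).im) p hp
  have hn : ∀ z : ℂ, ‖z‖ ^ (2 * p) ≤ 2 ^ (p - 1) * (z.re ^ (2 * p) + z.im ^ (2 * p)) := by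
    intro z
    rw [pow_mul, Complex.sq_norm, Complex.normSq_apply, pow_mul, pow_mul]
    have := add_pow_le (sq_nonneg z.re) (sq_nonneg z.im) p
    simpa [sq] using this
  have hre : ∀ σ : ι → Bool, (∑ i, (rsg (σ i) : ℂ) * b i).re = ∑ i, rsg (σ i) * (b i).re := by
    intro σ; simp
  have him : ∀ σ : ι → Bool, (∑ i, (rsg (σ i) : ℂ) * b i).im = ∑ i, rsg (σ i) * (b i).im := by
    intro σ; simp
  have hb1 : ∑ i, (b i).re ^ 2 ≤ ∑ i, ‖b i‖ ^ 2 := by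
    refine Finset.sum_le_sum fun i _ => ?_
    rw [Complex.sq_norm, Complex.normSq_apply]; nlinarith [sq_nonneg (b i).im]
  have hb2 : ∑ i, (b i).im ^ 2 ≤ ∑ i, ‖b i‖ ^ 2 := by
    refine Finset.sum_le_sum fun i _ => ?_
    rw [Complex.sq_norm, Complex.normSq_apply]; nlinarith [sq_nonneg (b i).re]
  set B := ∑ i, ‖b i‖ ^ 2
  have hre0 : 0 ≤ ∑ i, (b i).re ^ 2 := Finset.sum_nonneg fun i _ => sq_nonneg _
  have him0 : 0 ≤ ∑ i, (b i).im ^ 2 := Finset.sum_nonneg fun i _ => sq_nonneg _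
  calc _ ≤ ∑ σ : ι → Bool, 2 ^ (p - 1) * ((∑ i, rsg (σ i) * (b i).re) ^ (2 * p) +
          (∑ i, rsg (σ i) * (b i).im) ^ (2 * p)) := by
        refine Finset.sum_le_sum fun σ _ => ?_
        rw [← hre, ← him]; exact hn _
    _ = 2 ^ (p - 1) * (∑ σ : ι → Bool, (∑ i, rsg (σ i) * (b i).re) ^ (2 * p) +
          ∑ σ : ι → Bool, (∑ i, rsg (σ i) * (b i).im) ^ (2 * p)) := by
        rw [← Finset.mul_sum, Finset.sum_add_distrib]
    _ ≤ 2 ^ (p - 1) * (2 ^ Fintype.card ι * (12 * p * B) ^ p +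
          2 ^ Fintype.card ι * (12 * p * B) ^ p) := by
        apply mul_le_mul_of_nonneg_left _ (by positivity)
        apply add_le_add
        · refine h1.trans ?_
          gcongr
        · refine h2.trans ?_
          gcongr
    _ = _ := by
        obtain ⟨q, rfl⟩ : ∃ q, p = q + 1 := ⟨p - 1, by omega⟩
        have : (24 * ((q + 1 : ℕ) : ℝ)) * B = 2 * (12 * ((q + 1 : ℕ) : ℝ) * B) := by ring
        rw [this, mul_pow 2]
        simp only [Nat.add_sub_cancel]
        ring

/-- Minkowski-type inequality for finite sums. -/
lemma mink {ι : Type*} (E : Finset ι) (J : Finset ℕ) (hJ : J.Nonempty) (y : ℕ → ι → ℝ) (S : ℕ → ℝ)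
    (W : ℝ) (k : ℕ) (hk : 1 ≤ k) (hS : ∀ j ∈ J, 0 < S j) (hy : ∀ j ∈ J, ∀ e ∈ E, 0 ≤ y j e)
    (h : ∀ j ∈ J, ∑ e ∈ E, y j e ^ k ≤ W * S j ^ k) :
    ∑ e ∈ E, (∑ j ∈ J, y j e) ^ k ≤ W * (∑ j ∈ J, S j) ^ k := by
  set Q := ∑ j ∈ J, S j with hQ
  have hQ0 : 0 < Q := Finset.sum_pos hS hJ
  have h1 : ∀ e ∈ E, (∑ j ∈ J, y j e) ^ k ≤ ∑ j ∈ J, (S j / Q) * (y j e * Q / S j) ^ k := by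
    intro e he
    have := Real.pow_arith_mean_le_arith_mean_pow J (fun j => S j / Q) (fun j => y j e * Q / S j)
      (fun j hj => (div_pos (hS j hj) hQ0).le)
      (by rw [← Finset.sum_div, ← hQ, div_self hQ0.ne'])
      (fun j hj => div_nonneg (mul_nonneg (hy j hj e he) hQ0.le) (hS j hj).le) k
    refine le_trans (le_of_eq ?_) this
    congr 1
    refine Finset.sum_congr rfl fun j hj => ?_
    have := (hS j hj).ne'
    field_simp
  calc _ ≤ ∑ e ∈ E, ∑ j ∈ J, (S j / Q) * (y j e * Q / S j) ^ k := Finset.sum_le_sum h1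
    _ = ∑ j ∈ J, (S j / Q) * (Q / S j) ^ k * ∑ e ∈ E, y j e ^ k := by
        rw [Finset.sum_comm]
        refine Finset.sum_congr rfl fun j _ => ?_
        rw [Finset.mul_sum]
        refine Finset.sum_congr rfl fun e _ => ?_
        rw [mul_div_assoc, mul_pow]; ring
    _ ≤ ∑ j ∈ J, (S j / Q) * (Q / S j) ^ k * (W * S j ^ k) := by
        refine Finset.sum_le_sum fun j hj => ?_
        have := hS j hj
        exact mul_le_mul_of_nonneg_left (h j hj) (by positivity)
    _ = ∑ j ∈ J, (S j / Q) * (W * Q ^ k) := by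
        refine Finset.sum_congr rfl fun j hj => ?_
        have := (hS j hj).ne'
        rw [div_pow]; field_simp
    _ = _ := by rw [← Finset.sum_mul, ← Finset.sum_div, ← hQ, div_self hQ0.ne', one_mul]

/-- moment of the maximum of finitely many Rademacher sums -/
lemma max_moment (m r : ℕ) (hr : 1 ≤ r) (P : Finset (Fin m → ℝ)) (C ℓ : ℝ) (hC : 0 ≤ C)
    (hℓ : 0 ≤ ℓ) (hP : ∀ g ∈ P, ∑ i, g i ^ 2 ≤ C) (hcard : (P.card : ℝ) ≤ Real.exp ℓ)
    (y : (Fin m → Bool) → ℝ) (hy0 : ∀ e, 0 ≤ y e)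
    (hy : ∀ e, ∃ g ∈ P, y e ≤ |∑ i, rsg (e i) * g i|) :
    ∑ e, y e ^ (2 * r) ≤ 2 ^ m * (36 * (r + ℓ) * C) ^ r := by
  have hr' : (0:ℝ) < r := by exact_mod_cast hr
  set l := ⌊ℓ / r⌋₊ + 1 with hl
  have hl1 : 1 ≤ l := by omega
  have hlb : ℓ ≤ r * l := by
    have := (Nat.lt_floor_add_one (ℓ / r)).le
    rw [div_le_iff₀ hr'] at this
    push_cast [hl]; linarith
  have hub : (r:ℝ) * l ≤ r + ℓ := by
    have := Nat.floor_le (div_nonneg hℓ hr'.le)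
    rw [le_div_iff₀ hr'] at this
    push_cast [hl]; linarith
  have h2m : (0:ℝ) < 2 ^ m := by positivity
  have hcu : (Finset.univ : Finset (Fin m → Bool)).card = 2 ^ m := by simp
  -- high moment
  have hhigh : ∑ e, y e ^ (2 * (r * l)) ≤ 2 ^ m * (36 * (r + ℓ) * C) ^ (r * l) := by
    calc _ ≤ ∑ e : Fin m → Bool, ∑ g ∈ P, (∑ i, rsg (e i) * g i) ^ (2 * (r * l)) := by
          refine Finset.sum_le_sum fun e _ => ?_
          obtain ⟨g, hg, hle⟩ := hy e
          have h1 : y e ^ (2 * (r * l)) ≤ (∑ i, rsg (e i) * g i) ^ (2 * (r * l)) := by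
            refine (pow_le_pow_left₀ (hy0 e) hle _).trans (le_of_eq ?_)
            rw [pow_mul, sq_abs, ← pow_mul]
          refine h1.trans ?_
          exact Finset.single_le_sum (f := fun g : Fin m → ℝ =>
            (∑ i, rsg (e i) * g i) ^ (2 * (r * l)))
            (fun g _ => by simp only [pow_mul (_ : ℝ) 2]; positivity) hg
      _ = ∑ g ∈ P, ∑ e : Fin m → Bool, (∑ i, rsg (e i) * g i) ^ (2 * (r * l)) :=
          Finset.sum_comm
      _ ≤ ∑ g ∈ P, 2 ^ m * (12 * ((r * l : ℕ) : ℝ) * C) ^ (r * l) := by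
          refine Finset.sum_le_sum fun g hg => ?_
          refine (khin_real g (r * l) (Nat.mul_pos hr hl1)).trans ?_
          have := hP g hg
          have h0 : 0 ≤ ∑ i, g i ^ 2 := Finset.sum_nonneg fun i _ => sq_nonneg _
          rw [Fintype.card_fin]
          gcongr
      _ = P.card * (2 ^ m * (12 * ((r * l : ℕ) : ℝ) * C) ^ (r * l)) := by
          rw [Finset.sum_const, nsmul_eq_mul]
      _ ≤ 3 ^ (r * l) * (2 ^ m * (12 * (r + ℓ) * C) ^ (r * l)) := by
          have h3 : (P.card : ℝ) ≤ 3 ^ (r * l) := by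
            refine hcard.trans ?_
            refine (Real.exp_le_exp.2 hlb).trans ?_
            have : (r:ℝ) * l = ((r * l : ℕ) : ℝ) := by push_cast; ring
            rw [this, ← Real.exp_one_pow]
            exact pow_le_pow_left₀ (Real.exp_pos _).le (by linarith [Real.exp_one_lt_three]) _
          have h4 : ((r * l : ℕ) : ℝ) ≤ r + ℓ := by push_cast; exact hub
          gcongr
      _ = _ := by
          have : 36 * (r + ℓ) * C = 3 * (12 * (r + ℓ) * C) := by ring
          rw [this, mul_pow 3]; ring
  have hjensen : ((∑ e, y e ^ (2 * r)) / 2 ^ m) ^ l ≤ (∑ e, y e ^ (2 * (r * l))) / 2 ^ m := by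
    have := Real.pow_arith_mean_le_arith_mean_pow (Finset.univ : Finset (Fin m → Bool))
      (fun _ => (1:ℝ) / 2 ^ m) (fun e => y e ^ (2 * r)) (fun _ _ => by positivity)
      (by rw [Finset.sum_const, hcu]; simp) (fun e _ => pow_nonneg (hy0 e) _) l
    rw [← Finset.mul_sum, ← Finset.mul_sum] at this
    simp only [← pow_mul, ← mul_assoc] at this ⊢
    convert this using 1
    · ring
    · ring
  have h5 : ((∑ e, y e ^ (2 * r)) / 2 ^ m) ^ l ≤ ((36 * (r + ℓ) * C) ^ r) ^ l := by
    refine hjensen.trans ?_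
    rw [div_le_iff₀ h2m, ← pow_mul]
    linarith
  have h6 := le_of_pow_le_pow_left₀ (by omega) (by positivity) h5
  rw [div_le_iff₀ h2m] at h6
  linarith

lemma geom_h (n : ℕ) : ∑ j ∈ Finset.range n, (Real.sqrt (1/2)) ^ j ≤ 4 := by
  set h := Real.sqrt (1/2) with hh
  have h0 : 0 ≤ h := Real.sqrt_nonneg _
  have h1 : h ≤ 3/4 := by
    rw [hh, Real.sqrt_le_left (by norm_num)]; norm_num
  suffices H : ∑ j ∈ Finset.range n, h ^ j ≤ 4 * (1 - h ^ n) by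
    have : 0 ≤ h ^ n := by positivity
    linarith
  induction n with
  | zero => simp
  | succ n ih =>
    rw [Finset.sum_range_succ, pow_succ]
    have : 0 ≤ h ^ n := by positivity
    nlinarith

/-- abstract chaining -/
lemma chain {V : Type*} (m r J : ℕ) (hr : 1 ≤ r) (T : Finset V)
    (G : V → Fin m → ℝ) (g : ℕ → V → Fin m → ℝ) (C ℓ : ℝ) (hC : 0 < C) (hℓ : 0 ≤ ℓ)
    (hG : ∀ x ∈ T, ∀ i, G x i = ∑ j ∈ Finset.range (J + 1), g j x i)
    (hg : ∀ j < J + 1, ∀ x ∈ T, ∑ i, g j x i ^ 2 ≤ C * (1/2) ^ j)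
    (hcard : ∀ j < J + 1, ∃ P : Finset (Fin m → ℝ), (∀ x ∈ T, g j x ∈ P) ∧
      (∀ q ∈ P, ∃ x ∈ T, q = g j x) ∧ (P.card : ℝ) ≤ Real.exp (ℓ * 2 ^ j))
    (y : (Fin m → Bool) → ℝ) (hy0 : ∀ e, 0 ≤ y e)
    (hy : ∀ e, ∃ x ∈ T, y e ≤ |∑ i, rsg (e i) * G x i|) :
    ∑ e, y e ^ (2 * r) ≤ 2 ^ m * (72 * C * (16 * r + (J + 1) ^ 2 * ℓ)) ^ r := by
  choose x hxT hx using hy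
  have hr' : (0:ℝ) < r := by exact_mod_cast hr
  set h := Real.sqrt (1/2) with hh
  have hh2 : h ^ 2 = 1/2 := Real.sq_sqrt (by norm_num)
  have hhpos : 0 < h := Real.sqrt_pos.2 (by norm_num)
  set S : ℕ → ℝ := fun j => Real.sqrt (36 * C) * (Real.sqrt r * h ^ j + Real.sqrt ℓ) with hS
  have hSpos : ∀ j, 0 < S j := by
    intro j
    have : 0 < Real.sqrt r := Real.sqrt_pos.2 hr'
    have : 0 < Real.sqrt (36 * C) := Real.sqrt_pos.2 (by positivity)
    have : 0 ≤ Real.sqrt ℓ := Real.sqrt_nonneg _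
    simp only [hS]
    positivity
  set z : ℕ → (Fin m → Bool) → ℝ := fun j e => |∑ i, rsg (e i) * g j (x e) i| with hz
  have hlevel : ∀ j ∈ Finset.range (J + 1), ∑ e, z j e ^ (2 * r) ≤ 2 ^ m * S j ^ (2 * r) := by
    intro j hj
    rw [Finset.mem_range] at hj
    obtain ⟨P, hP1, hP2, hP3⟩ := hcard j hj
    have := max_moment m r hr P (C * (1/2) ^ j) (ℓ * 2 ^ j) (by positivity) (by positivity)
      (fun q hq => by
        obtain ⟨x, hxT, rfl⟩ := hP2 q hq
        exact hg j hj x hxT) hP3 (z j) (fun e => abs_nonneg _)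
      (fun e => ⟨g j (x e), hP1 _ (hxT e), le_rfl⟩)
    refine this.trans ?_
    rw [pow_mul (S j)]
    gcongr
    simp only [hS]
    rw [mul_pow, Real.sq_sqrt (by positivity)]
    have e1 : (2:ℝ) ^ j * (1/2) ^ j = 1 := by rw [← mul_pow]; norm_num
    have e2 : 36 * (r + ℓ * 2 ^ j) * (C * (1/2) ^ j) = 36 * C * (r * (1/2) ^ j + ℓ) := by
      linear_combination 36 * C * ℓ * e1
    rw [e2]
    apply mul_le_mul_of_nonneg_left _ (by positivity)
    have e3 : (h ^ j) ^ 2 = (1/2) ^ j := by rw [← pow_mul, mul_comm, pow_mul, hh2]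
    have e4 := Real.sq_sqrt hr'.le
    have e5 := Real.sq_sqrt hℓ
    have : 0 ≤ Real.sqrt r * h ^ j * Real.sqrt ℓ := by positivity
    have e6 : (Real.sqrt r * h ^ j + Real.sqrt ℓ) ^ 2 =
      (Real.sqrt r) ^ 2 * (h ^ j) ^ 2 + 2 * (Real.sqrt r * h ^ j * Real.sqrt ℓ) + Real.sqrt ℓ ^ 2 := by
      ring
    rw [e6, e3, e4, e5]; linarith
  have hm := mink Finset.univ (Finset.range (J + 1)) ⟨0, by simp⟩ z S (2 ^ m) (2 * r) (by omega)
    (fun j _ => hSpos j) (fun j _ e _ => abs_nonneg _) hlevel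
  have hle : ∑ e, y e ^ (2 * r) ≤ ∑ e, (∑ j ∈ Finset.range (J + 1), z j e) ^ (2 * r) := by
    refine Finset.sum_le_sum fun e _ => pow_le_pow_left₀ (hy0 e) ((hx e).trans ?_) _
    have : ∑ i, rsg (e i) * G (x e) i = ∑ j ∈ Finset.range (J + 1), ∑ i, rsg (e i) * g j (x e) i := by
      rw [Finset.sum_comm]
      refine Finset.sum_congr rfl fun i _ => ?_
      rw [hG _ (hxT e), Finset.mul_sum]
    rw [this]
    exact Finset.abs_sum_le_sum_abs _ _
  refine (hle.trans hm).trans ?_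
  have hsum : ∑ j ∈ Finset.range (J + 1), S j ≤
      Real.sqrt (36 * C) * (Real.sqrt r * 4 + (J + 1) * Real.sqrt ℓ) := by
    simp only [hS]
    rw [← Finset.mul_sum, Finset.sum_add_distrib, ← Finset.mul_sum]
    have := geom_h (J + 1)
    simp only [Finset.sum_const, Finset.card_range, nsmul_eq_mul]
    push_cast
    gcongr
  have hsum0 : 0 ≤ ∑ j ∈ Finset.range (J + 1), S j := Finset.sum_nonneg fun j _ => (hSpos j).le
  rw [pow_mul]
  have hsq : (∑ j ∈ Finset.range (J + 1), S j) ^ 2 ≤ 72 * C * (16 * r + (J + 1) ^ 2 * ℓ) := by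
    refine (pow_le_pow_left₀ hsum0 hsum 2).trans ?_
    rw [mul_pow, Real.sq_sqrt (by positivity)]
    have e4 := Real.sq_sqrt hr'.le
    have e5 := Real.sq_sqrt hℓ
    have : (Real.sqrt r * 4 + (J + 1) * Real.sqrt ℓ) ^ 2 ≤ 2 * (16 * r + (J + 1) ^ 2 * ℓ) := by
      nlinarith [sq_nonneg (Real.sqrt r * 4 - (J + 1) * Real.sqrt ℓ)]
    nlinarith
  gcongr

/-- average of the values `F` over a tuple of atoms -/
noncomputable def av {ι 𝒜 : Type*} [Fintype ι] {m : ℕ} (F : 𝒜 → Fin m → ℂ) (a : ι → 𝒜) (i : Fin m) : ℂ :=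
  (Fintype.card ι : ℂ)⁻¹ * ∑ l, F (a l) i

lemma mink2 {m : ℕ} (u v : Fin m → ℂ) (A B W : ℝ) (k : ℕ) (hk : 1 ≤ k) (hA : 0 < A) (hB : 0 < B)
    (hu : ∑ i, ‖u i‖ ^ k ≤ W * A ^ k) (hv : ∑ i, ‖v i‖ ^ k ≤ W * B ^ k) :
    ∑ i, ‖u i + v i‖ ^ k ≤ W * (A + B) ^ k := by
  have := mink (Finset.univ : Finset (Fin m)) (Finset.range 2) ⟨0, by simp⟩
    (fun j i => if j = 0 then ‖u i‖ else ‖v i‖) (fun j => if j = 0 then A else B) W k hk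
    (fun j _ => by split_ifs <;> assumption)
    (fun j _ e _ => by split_ifs <;> positivity)
    (fun j hj => by
      split_ifs
      · exact hu
      · exact hv)
  simp only [Finset.sum_range_succ, Finset.sum_range_zero] at this
  simp at this
  refine le_trans (Finset.sum_le_sum fun i _ => ?_) this
  exact pow_le_pow_left₀ (norm_nonneg _) (norm_add_le _ _) _

lemma halve {κ ι 𝒜 : Type*} [Fintype κ] [DecidableEq κ] [Fintype ι] {m : ℕ}
    (hcard : Fintype.card ι = 2 * Fintype.card κ) (hκ : 1 ≤ Fintype.card κ)
    (F : 𝒜 → Fin m → ℂ) (p : ℕ) (hp : 1 ≤ p) (k Γ : ℝ) (hk : 0 ≤ k)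
    (hF : ∀ x i, ‖F x i‖ ^ 2 ≤ k) (hF2 : ∀ x, ∑ i, ‖F x i‖ ^ 2 ≤ Γ)
    (a : ι → 𝒜) : ∃ b : κ → 𝒜,
      ∑ i, ‖av F a i - av F b i‖ ^ (2 * p) ≤
        (24 * p / Fintype.card κ) ^ p * (k ^ (p - 1) * Γ) := by
  obtain ⟨e⟩ : Nonempty (κ × Bool ≃ ι) := by
    rw [← Fintype.card_eq]; simp [hcard, mul_comm]
  set L : ℕ := Fintype.card κ with hL
  have hL0 : (0:ℝ) < L := by exact_mod_cast hκ
  have hLC : (L : ℂ) ≠ 0 := by exact_mod_cast (by omega : L ≠ 0)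
  set b : (κ → Bool) → κ → 𝒜 := fun σ l => a (e (l, σ l)) with hb
  set w : Fin m → κ → ℂ := fun i l => (2 * (L:ℂ))⁻¹ * (F (a (e (l, false))) i - F (a (e (l, true))) i)
    with hw
  have hdiff : ∀ σ i, av F a i - av F (b σ) i = ∑ l, (rsg (σ l) : ℂ) * w i l := by
    intro σ i
    simp only [av, hcard, ← hL]
    rw [← e.sum_comp, Fintype.sum_prod_type, Finset.mul_sum, Finset.mul_sum,
      ← Finset.sum_sub_distrib]
    refine Finset.sum_congr rfl fun l _ => ?_
    simp only [Fintype.sum_bool, hw, hb]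
    cases h : σ l
    · simp [rsg]; field_simp; ring
    · simp [rsg]; field_simp; ring
  -- V
  set V : Fin m → ℝ := fun i => (2 * (L:ℝ))⁻¹ * ∑ q, ‖F (a q) i‖ ^ 2 with hV
  have hV0 : ∀ i, 0 ≤ V i := fun i => by
    simp only [hV]; positivity
  have hVk : ∀ i, V i ≤ k := by
    intro i
    have : ∑ q, ‖F (a q) i‖ ^ 2 ≤ ∑ q : ι, k := Finset.sum_le_sum fun q _ => hF _ _
    rw [Finset.sum_const, Finset.card_univ, hcard, nsmul_eq_mul] at this
    simp only [hV]
    rw [inv_mul_le_iff₀ (by positivity)]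
    push_cast at this
    exact this
  have hVΓ : ∑ i, V i ≤ Γ := by
    simp only [hV]
    rw [← Finset.mul_sum, Finset.sum_comm, inv_mul_le_iff₀ (by positivity)]
    have : ∑ q, ∑ i, ‖F (a q) i‖ ^ 2 ≤ ∑ q : ι, Γ := Finset.sum_le_sum fun q _ => hF2 _
    rw [Finset.sum_const, Finset.card_univ, hcard, nsmul_eq_mul] at this
    push_cast at this
    exact this
  have hwV : ∀ i, ∑ l, ‖w i l‖ ^ 2 ≤ V i / L := by
    intro i
    have h1 : ∀ l, ‖w i l‖ ^ 2 ≤ (2 * (L:ℝ))⁻¹ ^ 2 * (2 * ∑ c : Bool, ‖F (a (e (l, c))) i‖ ^ 2) := by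
      intro l
      simp only [hw, norm_mul, mul_pow]
      have : ‖(2 * (L:ℂ))⁻¹‖ = (2 * (L:ℝ))⁻¹ := by simp
      rw [this]
      gcongr
      simp only [Fintype.sum_bool]
      have h := norm_sub_le (F (a (e (l, false))) i) (F (a (e (l, true))) i)
      have h0 := norm_nonneg (F (a (e (l, false))) i - F (a (e (l, true))) i)
      nlinarith [sq_nonneg (‖F (a (e (l, false))) i‖ - ‖F (a (e (l, true))) i‖)]
    refine (Finset.sum_le_sum fun l _ => h1 l).trans (le_of_eq ?_)
    rw [← Finset.mul_sum, ← Finset.mul_sum]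
    simp only [hV]
    rw [← e.sum_comp, Fintype.sum_prod_type]
    field_simp
  have hkh : ∀ i, ∑ σ : κ → Bool, ‖av F a i - av F (b σ) i‖ ^ (2 * p) ≤
      2 ^ L * ((24 * p / L) ^ p * (k ^ (p - 1) * V i)) := by
    intro i
    simp only [hdiff]
    refine (khin_complex (w i) p hp).trans ?_
    rw [← hL]
    apply mul_le_mul_of_nonneg_left _ (by positivity)
    calc (24 * p * ∑ l, ‖w i l‖ ^ 2) ^ p ≤ (24 * p * (V i / L)) ^ p := by
          gcongr; exact hwV i
      _ = (24 * p / L) ^ p * V i ^ p := by rw [← mul_pow]; congr 1; ring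
      _ ≤ _ := by
          gcongr
          obtain ⟨q, rfl⟩ : ∃ q, p = q + 1 := ⟨p - 1, by omega⟩
          rw [pow_succ, Nat.add_sub_cancel]
          exact mul_le_mul_of_nonneg_right (pow_le_pow_left₀ (hV0 i) (hVk i) _) (hV0 i)
  by_contra hcon
  push Not at hcon
  have hlt : ∑ σ : κ → Bool, (24 * p / (L:ℝ)) ^ p * (k ^ (p - 1) * Γ) <
      ∑ σ : κ → Bool, ∑ i, ‖av F a i - av F (b σ) i‖ ^ (2 * p) :=
    Finset.sum_lt_sum_of_nonempty Finset.univ_nonempty fun σ _ => hcon (b σ)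
  rw [Finset.sum_comm] at hlt
  have hle := Finset.sum_le_sum fun i (_ : i ∈ Finset.univ) => hkh i
  rw [← Finset.mul_sum, ← Finset.mul_sum, ← Finset.mul_sum] at hle
  have hc : ∑ σ : κ → Bool, (24 * p / (L:ℝ)) ^ p * (k ^ (p - 1) * Γ)
      = 2 ^ L * ((24 * p / (L:ℝ)) ^ p * (k ^ (p - 1) * Γ)) := by
    rw [Finset.sum_const, Finset.card_univ, nsmul_eq_mul]
    simp [hL]
  rw [hc] at hlt
  have : 2 ^ L * ((24 * p / (L:ℝ)) ^ p * (k ^ (p - 1) * ∑ i, V i)) ≤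
      2 ^ L * ((24 * p / (L:ℝ)) ^ p * (k ^ (p - 1) * Γ)) := by gcongr
  linarith

lemma iterhalve {𝒜 : Type*} {m : ℕ}
    (F : 𝒜 → Fin m → ℂ) (p : ℕ) (hp : 1 ≤ p) (k Γ : ℝ) (hk : 0 ≤ k) (hΓ : 0 ≤ Γ)
    (hF : ∀ x i, ‖F x i‖ ^ 2 ≤ k) (hF2 : ∀ x, ∑ i, ‖F x i‖ ^ 2 ≤ Γ) (J : ℕ)
    (a : Fin (p * 2 ^ J) → 𝒜) (d : ℕ) : ∀ j, j + d = J → ∃ b : Fin (p * 2 ^ j) → 𝒜,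
      ∑ i, ‖av F a i - av F b i‖ ^ (2 * p) ≤
        (k ^ (p - 1) * Γ) * (4 * Real.sqrt 24 * Real.sqrt (1/2) ^ j) ^ (2 * p) ∧
      (j = J → ∀ (n : ℕ) (F' : 𝒜 → Fin n → ℂ), av F' a = av F' b) := by
  have hh2 : Real.sqrt (1/2) ^ 2 = 1/2 := Real.sq_sqrt (by norm_num)
  have hhpos : 0 < Real.sqrt (1/2) := Real.sqrt_pos.2 (by norm_num)
  have h34 : Real.sqrt (1/2) ≤ 3/4 := by
    rw [Real.sqrt_le_left (by norm_num)]; norm_num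
  have hc2 : Real.sqrt 24 ^ 2 = 24 := Real.sq_sqrt (by norm_num)
  have hcpos : 0 < Real.sqrt 24 := Real.sqrt_pos.2 (by norm_num)
  set h := Real.sqrt (1/2)
  set c := Real.sqrt 24
  induction d with
  | zero =>
    intro j hj
    obtain rfl : j = J := by omega
    refine ⟨a, ?_, fun _ _ _ => rfl⟩
    have : 2 * p ≠ 0 := by omega
    simp [this]
    positivity
  | succ d ih =>
    intro j hj
    obtain ⟨b1, hb1, -⟩ := ih (j + 1) (by omega)
    obtain ⟨b, hb⟩ := halve (κ := Fin (p * 2 ^ j)) (ι := Fin (p * 2 ^ (j + 1)))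
      (by simp; ring) (by simp; exact Nat.pos_of_ne_zero (by positivity)) F p hp k Γ hk hF hF2 b1
    refine ⟨b, ?_, fun hjJ => by omega⟩
    have hp' : (0:ℝ) < p := by exact_mod_cast hp
    have hb' : ∑ i, ‖av F b1 i - av F b i‖ ^ (2 * p) ≤
        (k ^ (p - 1) * Γ) * (c * h ^ j) ^ (2 * p) := by
      refine hb.trans (le_of_eq ?_)
      rw [mul_comm]
      congr 1
      rw [pow_mul]
      congr 1
      rw [mul_pow, hc2, ← pow_mul, mul_comm j 2, pow_mul, hh2, Fintype.card_fin]
      push_cast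
      rw [one_div, inv_pow]
      field_simp
    have := mink2 (fun i => av F a i - av F b1 i) (fun i => av F b1 i - av F b i) _ _ _ (2 * p)
      (by omega) (by positivity) (by positivity) hb1 hb'
    simp only [sub_add_sub_cancel] at this
    refine this.trans ?_
    have : 4 * c * h ^ (j + 1) + c * h ^ j ≤ 4 * c * h ^ j := by
      rw [pow_succ]
      have : 0 < c * h ^ j := by positivity
      nlinarith
    gcongr

lemma metric_bd {m : ℕ} (f h : Fin m → ℂ) (p : ℕ) (hp : 1 ≤ p) (B M : ℝ) (hM : 0 < M) (hB : 0 ≤ B)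
    (hf : ∀ i, ‖f i‖ ^ 2 ≤ B) (hh : ∀ i, ‖h i‖ ^ 2 ≤ B)
    (hfM : ∑ i, ‖f i‖ ^ 2 ≤ M) (hhM : ∑ i, ‖h i‖ ^ 2 ≤ M) :
    (∑ i, (‖f i‖ ^ 2 - ‖h i‖ ^ 2) ^ 2) ^ p ≤
      (4 * M) ^ (p - 1) * (4 * B) * ∑ i, ‖f i - h i‖ ^ (2 * p) := by
  set b : Fin m → ℝ := fun i => ‖f i + h i‖ ^ 2 with hb
  set a : Fin m → ℝ := fun i => ‖f i - h i‖ ^ 2 with ha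
  have hb4 : ∀ i, b i ≤ 2 * (‖f i‖ ^ 2 + ‖h i‖ ^ 2) := by
    intro i
    simp only [hb]
    have h1 := norm_add_le (f i) (h i)
    have h0 := norm_nonneg (f i + h i)
    nlinarith [sq_nonneg (‖f i‖ - ‖h i‖)]
  have hb0 : ∀ i, 0 ≤ b i := fun i => sq_nonneg _
  have ha0 : ∀ i, 0 ≤ a i := fun i => sq_nonneg _
  have hab : ∀ i, (‖f i‖ ^ 2 - ‖h i‖ ^ 2) ^ 2 ≤ b i * a i := by
    intro i
    simp only [hb, ha]
    rw [← mul_pow]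
    rw [sq_le_sq, abs_of_nonneg (by positivity : 0 ≤ ‖f i + h i‖ * ‖f i - h i‖)]
    have h1 := abs_norm_sub_norm_le (f i) (h i)
    have key : ‖f i‖ ^ 2 - ‖h i‖ ^ 2 = ((f i + h i) * (starRingEnd ℂ) (f i - h i)).re := by
      rw [Complex.sq_norm, Complex.sq_norm, Complex.normSq_apply, Complex.normSq_apply]
      simp
      ring
    rw [key]
    refine (Complex.abs_re_le_norm _).trans ?_
    rw [norm_mul, RCLike.norm_conj]
  have hbs : ∑ i, b i ≤ 4 * M := by
    refine (Finset.sum_le_sum fun i _ => hb4 i).trans ?_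
    rw [← Finset.mul_sum, Finset.sum_add_distrib]; linarith
  have hs0 : 0 ≤ ∑ i, (‖f i‖ ^ 2 - ‖h i‖ ^ 2) ^ 2 := Finset.sum_nonneg fun i _ => sq_nonneg _
  refine (pow_le_pow_left₀ hs0 (Finset.sum_le_sum fun i _ => hab i) p).trans ?_
  have hbsum0 : 0 ≤ ∑ i, b i := Finset.sum_nonneg fun i _ => hb0 i
  have hJ : (∑ i, b i * a i) ^ p ≤ (∑ i, b i) ^ (p - 1) * ∑ i, b i * a i ^ p := by
    rcases hbsum0.eq_or_lt with h0 | hpos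
    · have hz : ∀ i, b i = 0 := fun i =>
        (Finset.sum_eq_zero_iff_of_nonneg (fun i _ => hb0 i)).1 h0.symm i (Finset.mem_univ i)
      have : p ≠ 0 := by omega
      simp [hz, this]
    · have := Real.pow_arith_mean_le_arith_mean_pow Finset.univ (fun i => b i / ∑ i, b i) a
        (fun i _ => div_nonneg (hb0 i) hpos.le) (by rw [← Finset.sum_div, div_self hpos.ne'])
        (fun i _ => ha0 i) p
      simp only [div_mul_eq_mul_div] at this
      rw [← Finset.sum_div, ← Finset.sum_div, div_pow, div_le_div_iff₀ (by positivity) hpos] at this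
      obtain ⟨q, rfl⟩ : ∃ q, p = q + 1 := ⟨p - 1, by omega⟩
      rw [Nat.add_sub_cancel]
      rw [pow_succ (∑ i, b i)] at this
      have h2 : (∑ i, b i * a i) ^ (q + 1) * ∑ i, b i ≤
        ((∑ i, b i) ^ q * ∑ i, b i * a i ^ (q + 1)) * ∑ i, b i := by linarith
      exact le_of_mul_le_mul_right h2 hpos
  refine hJ.trans ?_
  have h3 : ∑ i, b i * a i ^ p ≤ 4 * B * ∑ i, ‖f i - h i‖ ^ (2 * p) := by
    rw [Finset.mul_sum]
    refine Finset.sum_le_sum fun i _ => ?_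
    simp only [ha]
    rw [← pow_mul]
    apply mul_le_mul_of_nonneg_right _ (by positivity)
    linarith [hb4 i, hf i, hh i]
  have h4 : 0 ≤ ∑ i, b i * a i ^ p := Finset.sum_nonneg fun i _ =>
    mul_nonneg (hb0 i) (pow_nonneg (ha0 i) _)
  rw [mul_assoc]
  gcongr

/-- moment bound for the Rademacher process, conditionally on the sample -/
lemma cond_moment {𝒜 : Type*} [Fintype 𝒜] [Nonempty 𝒜] {m n : ℕ} (r J p s : ℕ) (hr : 1 ≤ r)
    (hp : 1 ≤ p) (hs : 1 ≤ s) (hsp : (s:ℝ) ≤ 3 ^ p)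
    (T : Finset (Fin n → ℂ)) (f : (Fin n → ℂ) → Fin m → ℂ)
    (F : 𝒜 → Fin m → ℂ) (F' : 𝒜 → Fin n → ℂ) (K M : ℝ) (hK : 0 < K) (hM : 0 < M)
    (hF : ∀ x i, ‖F x i‖ ^ 2 ≤ 2 * s * K ^ 2) (hF2 : ∀ x, ∑ i, ‖F x i‖ ^ 2 ≤ 2 * s * M)
    (hT : ∀ x ∈ T, ∃ a : Fin (p * 2 ^ J) → 𝒜, x = av F' a ∧ f x = av F a)
    (hfB : ∀ x ∈ T, ∀ i, ‖f x i‖ ^ 2 ≤ s * K ^ 2)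
    (hfM : ∀ x ∈ T, ∑ i, ‖f x i‖ ^ 2 ≤ M)
    (y : (Fin m → Bool) → ℝ) (hy0 : ∀ e, 0 ≤ y e)
    (hy : ∀ e, ∃ x ∈ T, y e ≤ |∑ i, rsg (e i) * ‖f x i‖ ^ 2|) :
    ∑ e, y e ^ (2 * r) ≤ 2 ^ m * (72 * (294912 * s * K ^ 2 * M) *
      (16 * r + (J + 1) ^ 2 * (2 * p * Real.log (Fintype.card 𝒜)))) ^ r := by
  classical
  have hs' : (0:ℝ) < s := by exact_mod_cast hs
  have hp' : (0:ℝ) < p := by exact_mod_cast hp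
  have hcA : 1 ≤ Fintype.card 𝒜 := Fintype.card_pos
  have hcA' : (1:ℝ) ≤ Fintype.card 𝒜 := by exact_mod_cast hcA
  have hlog : 0 ≤ Real.log (Fintype.card 𝒜) := Real.log_nonneg hcA'
  have hh2 : Real.sqrt (1/2) ^ 2 = 1/2 := Real.sq_sqrt (by norm_num)
  have hhpos : 0 < Real.sqrt (1/2) := Real.sqrt_pos.2 (by norm_num)
  have h34 : Real.sqrt (1/2) ≤ 3/4 := by
    rw [Real.sqrt_le_left (by norm_num)]; norm_num
  have hc2 : Real.sqrt 24 ^ 2 = 24 := Real.sq_sqrt (by norm_num)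
  have hcpos : 0 < Real.sqrt 24 := Real.sqrt_pos.2 (by norm_num)
  set h := Real.sqrt (1/2) with hhdef
  set c := Real.sqrt 24 with hcdef
  set W : ℝ := (2 * s * K ^ 2) ^ (p - 1) * (2 * s * M) with hW
  have hW0 : 0 < W := by positivity
  have hex : ∀ (j : ℕ) (x : Fin n → ℂ), ∃ b : Fin (p * 2 ^ j) → 𝒜, x ∈ T → j ≤ J →
      ∑ i, ‖f x i - av F b i‖ ^ (2 * p) ≤ W * (4 * c * h ^ j) ^ (2 * p) ∧
      (j = J → x = av F' b) := by
    intro j x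
    by_cases hx : x ∈ T ∧ j ≤ J
    · obtain ⟨a, ha1, ha2⟩ := hT x hx.1
      obtain ⟨b, hb1, hb2⟩ := iterhalve F p hp (2 * s * K ^ 2) (2 * s * M) (by positivity)
        (by positivity) hF hF2 J a (J - j) j (by omega)
      refine ⟨b, fun _ _ => ⟨?_, fun hj => ?_⟩⟩
      · rw [ha2]; exact hb1
      · rw [ha1]; exact hb2 hj n F'
    · exact ⟨fun _ => Classical.arbitrary _, fun h1 h2 => absurd ⟨h1, h2⟩ hx⟩
  choose H hH using hex
  set R : (j : ℕ) → (Fin (p * 2 ^ j) → 𝒜) → (Fin n → ℂ) := fun j b =>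
    if hb : ∃ x ∈ T, H j x = b then hb.choose else 0 with hR
  have hRspec : ∀ j x, x ∈ T → R j (H j x) ∈ T ∧ H j (R j (H j x)) = H j x := by
    intro j x hx
    have hb : ∃ x' ∈ T, H j x' = H j x := ⟨x, hx, rfl⟩
    simp only [hR, dif_pos hb]
    exact hb.choose_spec
  have hRJ : ∀ x ∈ T, R J (H J x) = x := by
    intro x hx
    obtain ⟨h1, h2⟩ := hRspec J x hx
    have h3 := (hH J x hx le_rfl).2 rfl
    have h4 := (hH J _ h1 le_rfl).2 rfl
    rw [h2] at h4
    rw [h4, ← h3]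
  set G : (Fin n → ℂ) → Fin m → ℝ := fun x i => ‖f x i‖ ^ 2 with hG
  set g : ℕ → (Fin n → ℂ) → Fin m → ℝ := fun j x => match j with
    | 0 => G (R 0 (H 0 x))
    | (j + 1) => fun i => G (R (j + 1) (H (j + 1) x)) i - G (R j (H j x)) i with hg
  have hclose : ∀ j ≤ J, ∀ x ∈ T,
      ∑ i, ‖f x i - f (R j (H j x)) i‖ ^ (2 * p) ≤ W * (8 * c * h ^ j) ^ (2 * p) := by
    intro j hj x hx
    obtain ⟨h1, h2⟩ := hRspec j x hx
    have h3 := (hH j x hx hj).1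
    have h4 := (hH j _ h1 hj).1
    rw [h2] at h4
    have h5 := mink2 (fun i => f x i - av F (H j x) i)
      (fun i => av F (H j x) i - f (R j (H j x)) i) (4 * c * h ^ j) (4 * c * h ^ j) W (2 * p) (by omega) (by positivity)
      (by positivity) h3 (by simpa only [norm_sub_rev] using h4)
    simp only [sub_add_sub_cancel] at h5
    refine h5.trans (le_of_eq ?_)
    ring
  refine chain m r J hr T G g (294912 * s * K ^ 2 * M) (2 * p * Real.log (Fintype.card 𝒜))
    (by positivity) (by positivity) ?_ ?_ ?_ y hy0 hy
  · intro x hx i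
    rw [Finset.sum_range_succ']
    simp only [hg]
    rw [Finset.sum_range_sub (fun j => G (R j (H j x)) i), hRJ x hx]
    ring
  · intro j hj x hx
    match j, hj with
    | 0, _ =>
      simp only [hg, hG]
      have h1 := (hRspec 0 x hx).1
      calc ∑ i, (‖f (R 0 (H 0 x)) i‖ ^ 2) ^ 2
          ≤ ∑ i, (s * K ^ 2) * ‖f (R 0 (H 0 x)) i‖ ^ 2 := by
            refine Finset.sum_le_sum fun i _ => ?_
            rw [sq (‖f (R 0 (H 0 x)) i‖ ^ 2)]
            exact mul_le_mul_of_nonneg_right (hfB _ h1 i) (sq_nonneg _)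
        _ ≤ (s * K ^ 2) * M := by
            rw [← Finset.mul_sum]
            exact mul_le_mul_of_nonneg_left (hfM _ h1) (by positivity)
        _ ≤ _ := by
            have : 0 < (s * K ^ 2) * M := by positivity
            simp only [pow_zero]
            nlinarith
    | (j + 1), hj =>
      simp only [hg, hG]
      have h1 := (hRspec (j + 1) x hx).1
      have h2 := (hRspec j x hx).1
      have h3 := hclose (j + 1) (by omega) x hx
      have h4 := hclose j (by omega) x hx
      have h5 := mink2 (fun i => f (R (j + 1) (H (j + 1) x)) i - f x i)
        (fun i => f x i - f (R j (H j x)) i) (8 * c * h ^ (j + 1)) (8 * c * h ^ j) W (2 * p) (by omega) (by positivity)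
        (by positivity) (by simpa only [norm_sub_rev] using h3) h4
      simp only [sub_add_sub_cancel] at h5
      have h6 : 8 * c * h ^ (j + 1) + 8 * c * h ^ j ≤ 16 * c * h ^ j := by
        rw [pow_succ]
        have : 0 < c * h ^ j := by positivity
        nlinarith
      have h7 : W * (8 * c * h ^ (j + 1) + 8 * c * h ^ j) ^ (2 * p) ≤
          W * (16 * c * h ^ j) ^ (2 * p) := by gcongr
      have h8 := metric_bd (f (R (j + 1) (H (j + 1) x))) (f (R j (H j x))) p hp (s * K ^ 2) M hM
        (by positivity) (hfB _ h1) (hfB _ h2) (hfM _ h1) (hfM _ h2)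
      have h9 : (16 * c * h ^ j) ^ (2 * p) = (6144 * (1/2) ^ j) ^ p := by
        rw [pow_mul]
        congr 1
        rw [mul_pow, mul_pow, hc2, ← pow_mul, mul_comm j 2, pow_mul, hh2]
        norm_num
      have h10 : (4 * M) ^ (p - 1) * (4 * (s * K ^ 2)) *
          ∑ i, ‖f (R (j + 1) (H (j + 1) x)) i - f (R j (H j x)) i‖ ^ (2 * p) ≤
          (294912 * s * K ^ 2 * M * (1/2) ^ (j + 1)) ^ p := by
        calc _ ≤ (4 * M) ^ (p - 1) * (4 * (s * K ^ 2)) * (W * (6144 * (1/2) ^ j) ^ p) := by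
              rw [← h9]
              exact mul_le_mul_of_nonneg_left (h5.trans h7) (by positivity)
          _ = (49152 * s * K ^ 2 * M * (1/2) ^ j) ^ p * s := by
              rw [hW]
              obtain ⟨q, rfl⟩ : ∃ q, p = q + 1 := ⟨p - 1, by omega⟩
              rw [Nat.add_sub_cancel]
              have : (49152:ℝ) = 4 * 2 * 6144 := by norm_num
              rw [this]
              simp only [mul_pow, pow_succ]
              ring
          _ ≤ (49152 * s * K ^ 2 * M * (1/2) ^ j) ^ p * 3 ^ p := by gcongr
          _ = _ := by
              rw [← mul_pow, pow_succ]
              congr 1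
              ring
      exact le_of_pow_le_pow_left₀ (by omega) (by positivity) (h8.trans h10)
  · intro j hj
    have hexp : ∀ N : ℕ, ((Fintype.card 𝒜 ^ N : ℕ) : ℝ) = Real.exp (N * Real.log (Fintype.card 𝒜)) := by
      intro N
      rw [Real.exp_nat_mul, Real.exp_log (by linarith)]
      push_cast; rfl
    refine ⟨T.image (g j), fun x hx => Finset.mem_image_of_mem _ hx, fun q hq => ?_, ?_⟩
    · obtain ⟨x, hx, rfl⟩ := Finset.mem_image.1 hq
      exact ⟨x, hx, rfl⟩
    match j, hj with
    | 0, _ =>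
      have h1 : (T.image (g 0)).card ≤ Fintype.card 𝒜 ^ p := by
        calc _ ≤ ((Finset.univ : Finset (Fin (p * 2 ^ 0) → 𝒜)).image fun b => G (R 0 b)).card := by
              apply Finset.card_le_card
              intro q hq
              obtain ⟨x, hx, rfl⟩ := Finset.mem_image.1 hq
              exact Finset.mem_image.2 ⟨H 0 x, Finset.mem_univ _, rfl⟩
          _ ≤ _ := Finset.card_image_le
          _ = _ := by simp
      have h2 : ((T.image (g 0)).card : ℝ) ≤ ((Fintype.card 𝒜 ^ p : ℕ) : ℝ) := by exact_mod_cast h1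
      rw [hexp] at h2
      refine h2.trans (Real.exp_le_exp.2 ?_)
      have : 0 ≤ p * Real.log (Fintype.card 𝒜) := by positivity
      simp only [pow_zero]
      linarith
    | (j + 1), _ =>
      have h1 : (T.image (g (j + 1))).card ≤ Fintype.card 𝒜 ^ (p * 2 ^ (j + 1) + p * 2 ^ j) := by
        calc _ ≤ ((Finset.univ : Finset ((Fin (p * 2 ^ (j + 1)) → 𝒜) × (Fin (p * 2 ^ j) → 𝒜))).image
                fun b => (fun i => G (R (j + 1) b.1) i - G (R j b.2) i)).card := by
              apply Finset.card_le_card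
              intro q hq
              obtain ⟨x, hx, rfl⟩ := Finset.mem_image.1 hq
              exact Finset.mem_image.2 ⟨(H (j + 1) x, H j x), Finset.mem_univ _, rfl⟩
          _ ≤ _ := Finset.card_image_le
          _ = _ := by simp [pow_add]
      have h2 : ((T.image (g (j + 1))).card : ℝ) ≤
        ((Fintype.card 𝒜 ^ (p * 2 ^ (j + 1) + p * 2 ^ j) : ℕ) : ℝ) := by exact_mod_cast h1
      rw [hexp] at h2
      refine h2.trans (Real.exp_le_exp.2 ?_)
      have : 0 ≤ p * Real.log (Fintype.card 𝒜) * 2 ^ j := by positivity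
      push_cast
      rw [pow_succ]
      linarith

abbrev Atm (N : ℕ) := Option (Fin N × Bool × Bool)

/-- atoms -/
noncomputable def avec {N : ℕ} (β : ℝ) : Atm N → Fin N → ℂ
  | none => fun _ => 0
  | some (j, b, c) => fun j' => if j' = j then (β : ℂ) * (rsg b : ℂ) * (if c then 1 else Complex.I) else 0

open Classical in
/-- the finite net -/
noncomputable def netF (N s n : ℕ) : Finset (Fin N → ℂ) :=
  ((Finset.univ : Finset (Fin n → Atm N)).image (fun a => av (avec (Real.sqrt (2 * s))) a)).filter
    (fun x => IsSparse s x ∧ ∑ j, ‖x j‖ ^ 2 ≤ 1)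

lemma mem_netF {N s n : ℕ} {x : Fin N → ℂ} : x ∈ netF N s n ↔
    (∃ a : Fin n → Atm N, av (avec (Real.sqrt (2 * s))) a = x) ∧ IsSparse s x ∧ ∑ j, ‖x j‖ ^ 2 ≤ 1 := by
  simp [netF]

lemma zero_mem_netF (N s n : ℕ) : (0 : Fin N → ℂ) ∈ netF N s n := by
  rw [mem_netF]
  refine ⟨⟨fun _ => none, ?_⟩, ⟨∅, by simp, by simp⟩, by simp⟩
  ext j
  simp [av, avec]

lemma exists_tuple {𝒜 : Type*} [Fintype 𝒜] (c : 𝒜 → ℕ) (n : ℕ) (h : ∑ a, c a = n) :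
    ∃ a : Fin n → 𝒜, ∀ g : 𝒜 → ℂ, ∑ l, g (a l) = ∑ x, (c x : ℂ) * g x := by
  obtain ⟨e⟩ : Nonempty (Fin n ≃ (Σ x : 𝒜, Fin (c x))) := by
    rw [← Fintype.card_eq]; simp [h]
  refine ⟨fun l => (e l).1, fun g => ?_⟩
  rw [e.sum_comp (fun q : (Σ x : 𝒜, Fin (c x)) => g q.1), Fintype.sum_sigma]
  simp

/-- rounding towards zero to the grid of width `q` -/
noncomputable def rnd (q y : ℝ) : ℝ := q * ((⌊y / q⌋₊ : ℝ) - (⌊-y / q⌋₊ : ℝ))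

lemma rnd_facts {q : ℝ} (hq : 0 < q) (y : ℝ) :
    |rnd q y| ≤ |y| ∧ |y - rnd q y| ≤ q ∧ q * ((⌊y / q⌋₊ : ℝ) + (⌊-y / q⌋₊ : ℝ)) ≤ |y| := by
  unfold rnd
  rcases le_total 0 y with hy | hy
  · have h1 : ⌊-y / q⌋₊ = 0 := by
      apply Nat.floor_of_nonpos
      exact div_nonpos_of_nonpos_of_nonneg (by linarith) hq.le
    have h2 := Nat.floor_le (div_nonneg hy hq.le)
    have h3 := Nat.lt_floor_add_one (y / q)
    rw [le_div_iff₀ hq] at h2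
    rw [div_lt_iff₀ hq] at h3
    have h4 : (0:ℝ) ≤ ⌊y / q⌋₊ := by positivity
    rw [h1, abs_of_nonneg hy]
    simp only [Nat.cast_zero, sub_zero, add_zero]
    refine ⟨?_, ?_, by linarith⟩
    · rw [abs_of_nonneg (by positivity)]; linarith
    · rw [abs_le]; constructor <;> linarith
  · have h1 : ⌊y / q⌋₊ = 0 := by
      apply Nat.floor_of_nonpos
      exact div_nonpos_of_nonpos_of_nonneg (by linarith) hq.le
    have h2 := Nat.floor_le (div_nonneg (neg_nonneg.2 hy) hq.le)
    have h3 := Nat.lt_floor_add_one (-y / q)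
    rw [le_div_iff₀ hq] at h2
    rw [div_lt_iff₀ hq] at h3
    have h4 : (0:ℝ) ≤ ⌊-y / q⌋₊ := by positivity
    have h5 : 0 ≤ q * ⌊-y / q⌋₊ := by positivity
    rw [h1, abs_of_nonpos hy]
    simp only [Nat.cast_zero, zero_sub, zero_add]
    refine ⟨?_, ?_, by linarith⟩
    · rw [abs_of_nonpos (by linarith)]; linarith
    · rw [abs_le]; constructor <;> linarith

lemma rnd_zero (q : ℝ) : rnd q 0 = 0 := by simp [rnd]

lemma net_approx {N s n : ℕ} (hs : 1 ≤ s) (hn : 8 * s ≤ n) (S : Finset (Fin N)) (hS : S.card ≤ s)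
    (x : Fin N → ℂ) (hx : ∀ j ∉ S, x j = 0) (hx1 : ∑ j, ‖x j‖ ^ 2 ≤ 1) :
    ∃ z ∈ netF N s n, (∀ j ∉ S, z j = 0) ∧ ∑ j, ‖x j - z j‖ ^ 2 ≤ 1 / 16 := by
  have hs' : (1:ℝ) ≤ s := by exact_mod_cast hs
  have hn' : (8:ℝ) * s ≤ n := by exact_mod_cast hn
  have hn0 : (0:ℝ) < n := by linarith
  set β := Real.sqrt (2 * s) with hβ
  have hβ2 : β ^ 2 = 2 * s := Real.sq_sqrt (by positivity)
  have hβ0 : 0 < β := Real.sqrt_pos.2 (by positivity)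
  set q := β / n with hq
  have hq0 : 0 < q := by positivity
  set cnt : Fin N × Bool × Bool → ℕ := fun t =>
    ⌊(rsg t.2.1 * (if t.2.2 then (x t.1).re else (x t.1).im)) / q⌋₊ with hcnt
  have hsumc : ∑ t, (cnt t : ℝ) = ∑ j, (((⌊(x j).re / q⌋₊ : ℝ) + (⌊-(x j).re / q⌋₊ : ℝ)) +
      ((⌊(x j).im / q⌋₊ : ℝ) + (⌊-(x j).im / q⌋₊ : ℝ))) := by
    rw [Fintype.sum_prod_type]
    refine Finset.sum_congr rfl fun j _ => ?_
    rw [Fintype.sum_prod_type]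
    simp [hcnt, rsg]
    ring
  have habs : ∑ j, (|(x j).re| + |(x j).im|) ≤ β := by
    have h1 : ∑ j, (|(x j).re| + |(x j).im|) = ∑ j ∈ S, (|(x j).re| + |(x j).im|) := by
      symm
      apply Finset.sum_subset (Finset.subset_univ _)
      intro j _ hj
      simp [hx j hj]
    rw [h1]
    apply Real.le_sqrt_of_sq_le
    refine (sq_sum_le_card_mul_sum_sq).trans ?_
    have h2 : ∑ j ∈ S, (|(x j).re| + |(x j).im|) ^ 2 ≤ 2 := by
      calc _ ≤ ∑ j, (|(x j).re| + |(x j).im|) ^ 2 :=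
            Finset.sum_le_sum_of_subset_of_nonneg (Finset.subset_univ _) fun _ _ _ => sq_nonneg _
        _ ≤ ∑ j, 2 * ‖x j‖ ^ 2 := by
            refine Finset.sum_le_sum fun j _ => ?_
            rw [Complex.sq_norm, Complex.normSq_apply]
            nlinarith [sq_nonneg (|(x j).re| - |(x j).im|), sq_abs (x j).re, sq_abs (x j).im]
        _ ≤ 2 := by rw [← Finset.mul_sum]; linarith
    have h3 : (S.card : ℝ) ≤ s := by exact_mod_cast hS
    have h4 : 0 ≤ ∑ j ∈ S, (|(x j).re| + |(x j).im|) ^ 2 := Finset.sum_nonneg fun _ _ => sq_nonneg _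
    nlinarith
  have hcn : ∑ t, cnt t ≤ n := by
    have h1 : q * ∑ t, (cnt t : ℝ) ≤ β := by
      refine le_trans ?_ habs
      rw [hsumc, Finset.mul_sum]
      refine Finset.sum_le_sum fun j _ => ?_
      have := (rnd_facts hq0 (x j).re).2.2
      have := (rnd_facts hq0 (x j).im).2.2
      rw [mul_add]
      linarith
    have h2 : ∑ t, (cnt t : ℝ) ≤ n := by
      rw [hq, div_mul_eq_mul_div, div_le_iff₀ hn0] at h1
      exact le_of_mul_le_mul_left h1 hβ0
    exact_mod_cast h2
  obtain ⟨a, ha⟩ := exists_tuple (𝒜 := Atm N)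
    (fun o => match o with
      | none => n - ∑ t, cnt t
      | some t => cnt t) n (by
        rw [Fintype.sum_option]; simp only; omega)
  set z : Fin N → ℂ := fun j => (rnd q (x j).re : ℂ) + (rnd q (x j).im : ℂ) * Complex.I with hz
  have hav : av (avec β) a = z := by
    ext j
    simp only [av, Fintype.card_fin]
    rw [ha (fun o => avec β o j), Fintype.sum_option]
    simp only [avec, mul_zero, zero_add]
    rw [Fintype.sum_prod_type]
    rw [Finset.sum_eq_single j]
    · rw [Fintype.sum_prod_type]
      simp only [Fintype.sum_bool, hcnt, rsg, hz, rnd, hq]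
      simp
      field_simp
      ring
    · intro j' _ hne
      refine Finset.sum_eq_zero fun t _ => ?_
      simp [hne.symm]
    · simp
  have hzS : ∀ j ∉ S, z j = 0 := by
    intro j hj
    simp [hz, hx j hj, rnd_zero]
  have hre : ∀ j, (z j).re = rnd q (x j).re := by intro j; simp [hz]
  have him : ∀ j, (z j).im = rnd q (x j).im := by intro j; simp [hz]
  refine ⟨z, ?_, hzS, ?_⟩
  · rw [mem_netF]
    refine ⟨⟨a, hav⟩, ⟨S, hS, hzS⟩, le_trans (Finset.sum_le_sum fun j _ => ?_) hx1⟩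
    rw [Complex.sq_norm, Complex.sq_norm, Complex.normSq_apply, Complex.normSq_apply, hre, him]
    have h1 := sq_le_sq.2 (rnd_facts hq0 (x j).re).1
    have h2 := sq_le_sq.2 (rnd_facts hq0 (x j).im).1
    nlinarith
  · have h1 : ∑ j, ‖x j - z j‖ ^ 2 = ∑ j ∈ S, ‖x j - z j‖ ^ 2 := by
      symm
      apply Finset.sum_subset (Finset.subset_univ _)
      intro j _ hj
      simp [hx j hj, hzS j hj]
    rw [h1]
    have h2 : ∀ j ∈ S, ‖x j - z j‖ ^ 2 ≤ 2 * q ^ 2 := by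
      intro j _
      rw [Complex.sq_norm, Complex.normSq_apply, Complex.sub_re, Complex.sub_im, hre, him]
      have h1 := sq_le_sq' (abs_le.1 (rnd_facts hq0 (x j).re).2.1).1 (abs_le.1 (rnd_facts hq0 (x j).re).2.1).2
      have h2 := sq_le_sq' (abs_le.1 (rnd_facts hq0 (x j).im).2.1).1 (abs_le.1 (rnd_facts hq0 (x j).im).2.1).2
      nlinarith
    refine (Finset.sum_le_sum h2).trans ?_
    rw [Finset.sum_const, nsmul_eq_mul]
    have h3 : (S.card : ℝ) ≤ s := by exact_mod_cast hS
    have h4 : q ^ 2 * n ^ 2 = 2 * s := by rw [hq, div_pow, hβ2]; field_simp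
    have h5 : (S.card : ℝ) * (2 * q ^ 2) ≤ s * (2 * q ^ 2) := by gcongr
    refine h5.trans ?_
    have h6 : 64 * (s:ℝ) ^ 2 ≤ n ^ 2 := by nlinarith
    have h7 : q ^ 2 * (64 * (s:ℝ) ^ 2) ≤ 2 * s := by
      rw [← h4]; gcongr
    have h8 : (q ^ 2 * 32 * s) * s ≤ 1 * s := by nlinarith
    have h9 := le_of_mul_le_mul_right h8 (by linarith)
    linarith

/-- quadratic form of `A^* A - I` -/
noncomputable def qf {m N : ℕ} (a : Fin m → Fin N → ℂ) (x : Fin N → ℂ) : ℝ :=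
  (∑ i, ‖∑ j, a i j * x j‖ ^ 2) / m - ∑ j, ‖x j‖ ^ 2

lemma nsq_diff (u w : ℂ) : ‖(5/2) * u - (3/2) * w‖ ^ 2 - ‖(3/2) * u - (5/2) * w‖ ^ 2 =
    4 * (‖u‖ ^ 2 - ‖w‖ ^ 2) := by
  simp only [Complex.sq_norm, Complex.normSq_apply]
  simp
  ring

lemma nsq_sum (u w : ℂ) : ‖(5/2) * u - (3/2) * w‖ ^ 2 + ‖(3/2) * u - (5/2) * w‖ ^ 2 ≤
    8 * ‖u - w‖ ^ 2 + ‖u‖ ^ 2 + ‖w‖ ^ 2 := by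
  simp only [Complex.sq_norm, Complex.normSq_apply]
  simp
  nlinarith [sq_nonneg (u.re - w.re), sq_nonneg (u.im - w.im)]

lemma qf_diff {m N : ℕ} (a : Fin m → Fin N → ℂ) (x z : Fin N → ℂ) :
    qf a (fun j => (5/2) * x j - (3/2) * z j) - qf a (fun j => (3/2) * x j - (5/2) * z j) =
      4 * (qf a x - qf a z) := by
  have hl : ∀ (i : Fin m) (c d : ℂ), ∑ j, a i j * (c * x j - d * z j) =
      c * (∑ j, a i j * x j) - d * ∑ j, a i j * z j := by
    intro i c d
    rw [Finset.mul_sum, Finset.mul_sum, ← Finset.sum_sub_distrib]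
    exact Finset.sum_congr rfl fun j _ => by ring
  have h1 : ∑ i, ‖∑ j, a i j * ((5/2) * x j - (3/2) * z j)‖ ^ 2 -
      ∑ i, ‖∑ j, a i j * ((3/2) * x j - (5/2) * z j)‖ ^ 2 =
      4 * (∑ i, ‖∑ j, a i j * x j‖ ^ 2 - ∑ i, ‖∑ j, a i j * z j‖ ^ 2) := by
    rw [← Finset.sum_sub_distrib, ← Finset.sum_sub_distrib, Finset.mul_sum]
    refine Finset.sum_congr rfl fun i _ => ?_
    rw [hl, hl, nsq_diff]
  have h2 : ∑ j, ‖(5/2) * x j - (3/2) * z j‖ ^ 2 - ∑ j, ‖(3/2) * x j - (5/2) * z j‖ ^ 2 =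
      4 * (∑ j, ‖x j‖ ^ 2 - ∑ j, ‖z j‖ ^ 2) := by
    rw [← Finset.sum_sub_distrib, ← Finset.sum_sub_distrib, Finset.mul_sum]
    exact Finset.sum_congr rfl fun i _ => nsq_diff _ _
  simp only [qf]
  linear_combination (1 / (m:ℝ)) * h1 - h2

lemma qf_smul {m N : ℕ} (a : Fin m → Fin N → ℂ) (x : Fin N → ℂ) (c : ℝ) :
    qf a (fun j => (c:ℂ) * x j) = c ^ 2 * qf a x := by
  have h1 : ∀ i, ∑ j, a i j * ((c:ℂ) * x j) = c * ∑ j, a i j * x j := by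
    intro i
    rw [Finset.mul_sum]; exact Finset.sum_congr rfl fun j _ => by ring
  simp only [qf, h1, norm_mul, mul_pow, Complex.norm_real, Real.norm_eq_abs, sq_abs]
  rw [← Finset.mul_sum, ← Finset.mul_sum]
  ring

lemma lin_sq_le {N : ℕ} (S : Finset (Fin N)) (b x : Fin N → ℂ) (hx : ∀ j ∉ S, x j = 0) :
    ‖∑ j, b j * x j‖ ^ 2 ≤ (∑ j ∈ S, ‖b j‖ ^ 2) * ∑ j, ‖x j‖ ^ 2 := by
  have h1 : ∑ j, b j * x j = ∑ j ∈ S, b j * x j := by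
    symm
    apply Finset.sum_subset (Finset.subset_univ _)
    intro j _ hj
    simp [hx j hj]
  have h2 : ∑ j ∈ S, ‖x j‖ ^ 2 ≤ ∑ j, ‖x j‖ ^ 2 :=
    Finset.sum_le_sum_of_subset_of_nonneg (Finset.subset_univ _) fun _ _ _ => sq_nonneg _
  rw [h1]
  have h3 : ‖∑ j ∈ S, b j * x j‖ ≤ ∑ j ∈ S, ‖b j‖ * ‖x j‖ := by
    refine (norm_sum_le _ _).trans (le_of_eq ?_)
    simp
  calc _ ≤ (∑ j ∈ S, ‖b j‖ * ‖x j‖) ^ 2 := pow_le_pow_left₀ (norm_nonneg _) h3 2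
    _ ≤ (∑ j ∈ S, ‖b j‖ ^ 2) * ∑ j ∈ S, ‖x j‖ ^ 2 := Finset.sum_mul_sq_le_sq_mul_sq _ _ _
    _ ≤ _ := by gcongr

lemma net_rip {m N s n : ℕ} (hs : 1 ≤ s) (hn : 8 * s ≤ n) (a : Fin m → Fin N → ℂ)
    (Z : ℝ) (hZ : ∀ z ∈ netF N s n, |qf a z| ≤ Z) (x : Fin N → ℂ) (hx : IsSparse s x) :
    |qf a x| ≤ 3 * Z * ∑ j, ‖x j‖ ^ 2 := by
  obtain ⟨S, hS, hxS⟩ := hx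
  have hZ0 : 0 ≤ Z := (abs_nonneg _).trans (hZ 0 (zero_mem_netF N s n))
  have step : ∀ b : ℝ, 0 ≤ b → (∀ x : Fin N → ℂ, (∀ j ∉ S, x j = 0) → |qf a x| ≤ b * ∑ j, ‖x j‖ ^ 2) →
      ∀ x : Fin N → ℂ, (∀ j ∉ S, x j = 0) → |qf a x| ≤ (Z + 5/8 * b) * ∑ j, ‖x j‖ ^ 2 := by
    intro b hb0 hb x hx
    have hunit : ∀ x : Fin N → ℂ, (∀ j ∉ S, x j = 0) → ∑ j, ‖x j‖ ^ 2 ≤ 1 →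
        |qf a x| ≤ Z + 5/8 * b := by
      intro x hx hx1
      obtain ⟨z, hz, hzS, hxz⟩ := net_approx hs hn S hS x hx hx1
      have hz1 := (mem_netF.1 hz).2.2
      have hP := hb (fun j => (5/2) * x j - (3/2) * z j) (fun j hj => by simp [hx j hj, hzS j hj])
      have hQ := hb (fun j => (3/2) * x j - (5/2) * z j) (fun j hj => by simp [hx j hj, hzS j hj])
      have hd := qf_diff a x z
      have hsum : ∑ j, ‖(5/2) * x j - (3/2) * z j‖ ^ 2 + ∑ j, ‖(3/2) * x j - (5/2) * z j‖ ^ 2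
          ≤ 5/2 := by
        rw [← Finset.sum_add_distrib]
        refine (Finset.sum_le_sum fun j _ => nsq_sum (x j) (z j)).trans ?_
        rw [Finset.sum_add_distrib, Finset.sum_add_distrib, ← Finset.mul_sum]
        linarith
      have hzZ := hZ z hz
      have hm : b * (∑ j, ‖(5/2) * x j - (3/2) * z j‖ ^ 2 + ∑ j, ‖(3/2) * x j - (5/2) * z j‖ ^ 2)
          ≤ b * (5/2) := mul_le_mul_of_nonneg_left hsum hb0
      rw [abs_le] at *
      constructor <;> linarith [hP.1, hP.2, hQ.1, hQ.2, hzZ.1, hzZ.2]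
    set Q := ∑ j, ‖x j‖ ^ 2 with hQ
    have hQ0 : 0 ≤ Q := Finset.sum_nonneg fun _ _ => sq_nonneg _
    rcases hQ0.eq_or_lt with h0 | hpos
    · have hz : ∀ j, x j = 0 := by
        intro j
        have := (Finset.sum_eq_zero_iff_of_nonneg (fun i _ => sq_nonneg (‖x i‖))).1 h0.symm j
          (Finset.mem_univ j)
        simpa using this
      rw [← h0]
      simp [qf, hz]
    · have hsq : (Real.sqrt Q)⁻¹ ^ 2 = Q⁻¹ := by rw [inv_pow, Real.sq_sqrt hQ0]
      have h1 := hunit (fun j => (((Real.sqrt Q)⁻¹ : ℝ) : ℂ) * x j) (fun j hj => by simp [hx j hj])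
        (by
          simp only [norm_mul, mul_pow, Complex.norm_real, Real.norm_eq_abs, sq_abs]
          rw [← Finset.mul_sum, hsq, ← hQ, inv_mul_cancel₀ hpos.ne'])
      rw [qf_smul, hsq, abs_mul, abs_of_pos (inv_pos.2 hpos), inv_mul_le_iff₀ hpos] at h1
      linarith
  set b0 : ℝ := (∑ i, ∑ j ∈ S, ‖a i j‖ ^ 2) / m + 1 with hb0
  have hb00 : 0 ≤ b0 := by positivity
  have hinit : ∀ x : Fin N → ℂ, (∀ j ∉ S, x j = 0) → |qf a x| ≤ b0 * ∑ j, ‖x j‖ ^ 2 := by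
    intro x hx
    have h1 : (∑ i, ‖∑ j, a i j * x j‖ ^ 2) / m ≤ (∑ i, ∑ j ∈ S, ‖a i j‖ ^ 2) / m * ∑ j, ‖x j‖ ^ 2 := by
      rw [div_mul_eq_mul_div]
      gcongr
      rw [Finset.sum_mul]
      exact Finset.sum_le_sum fun i _ => lin_sq_le S (a i) x hx
    have h2 : 0 ≤ (∑ i, ‖∑ j, a i j * x j‖ ^ 2) / m := by positivity
    have h3 : 0 ≤ ∑ j, ‖x j‖ ^ 2 := by positivity
    have h4 : 0 ≤ (∑ i, ∑ j ∈ S, ‖a i j‖ ^ 2) / m * ∑ j, ‖x j‖ ^ 2 := by positivity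
    rw [abs_le, hb0]
    simp only [qf]
    constructor <;> linarith
  have hiter : ∀ k : ℕ, ∀ x : Fin N → ℂ, (∀ j ∉ S, x j = 0) →
      |qf a x| ≤ (8/3 * Z + (5/8) ^ k * b0) * ∑ j, ‖x j‖ ^ 2 := by
    intro k
    induction k with
    | zero =>
      intro x hx
      refine (hinit x hx).trans ?_
      have h3 : 0 ≤ ∑ j, ‖x j‖ ^ 2 := by positivity
      simp only [pow_zero]
      nlinarith
    | succ k ih =>
      intro x hx
      refine (step _ (by positivity) ih x hx).trans (le_of_eq ?_)
      rw [pow_succ]; ring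
  have hlim : Filter.Tendsto (fun k : ℕ => (8/3 * Z + (5/8) ^ k * b0) * ∑ j, ‖x j‖ ^ 2) Filter.atTop
      (nhds ((8/3 * Z + 0 * b0) * ∑ j, ‖x j‖ ^ 2)) := by
    apply Filter.Tendsto.mul_const
    apply Filter.Tendsto.const_add
    apply Filter.Tendsto.mul_const
    exact tendsto_pow_atTop_nhds_zero_of_lt_one (by norm_num) (by norm_num)
  have h1 := ge_of_tendsto' hlim (fun k => hiter k x hxS)
  have h3 : 0 ≤ ∑ j, ‖x j‖ ^ 2 := by positivity
  nlinarith

lemma norm_rsg (b : Bool) : ‖((rsg b : ℝ) : ℂ)‖ = 1 := by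
  cases b <;> simp [rsg]

lemma cond_spec {m N : ℕ} (r J p s : ℕ) (hm : 1 ≤ m) (hr : 1 ≤ r) (hp : 1 ≤ p) (hs : 1 ≤ s)
    (hsp : (s:ℝ) ≤ 3 ^ p) (hJ : 8 * s ≤ p * 2 ^ J)
    (a : Fin m → Fin N → ℂ) (K Z : ℝ) (hK : 0 < K) (ha : ∀ i j, ‖a i j‖ ≤ K)
    (hZ : ∀ z ∈ netF N s (p * 2 ^ J), |qf a z| ≤ Z)
    (y : (Fin m → Bool) → ℝ) (hy0 : ∀ e, 0 ≤ y e)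
    (hy : ∀ e, ∃ x ∈ netF N s (p * 2 ^ J), y e ≤ |∑ i, rsg (e i) * ‖∑ j, a i j * x j‖ ^ 2|) :
    ∑ e, y e ^ (2 * r) ≤ 2 ^ m * (72 * (294912 * s * K ^ 2 * (m * (1 + 3 * Z))) *
      (16 * r + (J + 1) ^ 2 * (2 * p * Real.log (4 * N + 1)))) ^ r := by
  have hZ0 : 0 ≤ Z := (abs_nonneg _).trans (hZ 0 (zero_mem_netF N s _))
  have hm' : (1:ℝ) ≤ m := by exact_mod_cast hm
  have hs' : (1:ℝ) ≤ s := by exact_mod_cast hs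
  have hb : ∀ j : Fin N, ∀ i, ‖a i j‖ ^ 2 ≤ K ^ 2 := fun j i => by
    have := ha i j; gcongr
  have hcol : ∀ j : Fin N, ∑ i, ‖a i j‖ ^ 2 ≤ m * (1 + 3 * Z) := by
    intro j
    have h := net_rip hs hJ a Z hZ (Pi.single j 1) ⟨{j}, by simpa using hs, by
      intro i hi; simp at hi; simp [Pi.single_apply, hi]⟩
    have h1 : ∑ j', ‖(Pi.single j (1:ℂ) : Fin N → ℂ) j'‖ ^ 2 = 1 := by
      rw [Finset.sum_eq_single j] <;> simp +contextual [Pi.single_apply]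
    have h2 : ∀ i, ∑ j', a i j' * (Pi.single j (1:ℂ) : Fin N → ℂ) j' = a i j := by
      intro i
      rw [Finset.sum_eq_single j] <;> simp +contextual [Pi.single_apply]
    rw [qf, h1] at h
    simp only [h2] at h
    have h3 := (abs_le.1 h).2
    have h4 : (∑ i, ‖a i j‖ ^ 2) / m ≤ 1 + 3 * Z := by linarith
    rw [div_le_iff₀ (by linarith)] at h4
    linarith
  have hav : ∀ (j : Fin N) (b c : Bool) (i : Fin m),
      ‖∑ j', a i j' * avec (Real.sqrt (2 * s)) (some (j, b, c)) j'‖ ^ 2 = 2 * s * ‖a i j‖ ^ 2 := by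
    intro j b c i
    rw [Finset.sum_eq_single j]
    · simp only [avec, if_true, norm_mul, norm_rsg, mul_pow]
      have : ‖(if c = true then (1:ℂ) else Complex.I)‖ = 1 := by cases c <;> simp
      rw [this, Complex.norm_real, Real.norm_eq_abs, sq_abs, Real.sq_sqrt (by positivity)]
      ring
    · intro j' _ hj'
      simp [avec, hj']
    · simp
  have key := cond_moment (𝒜 := Atm N) (m := m) (n := N) r J p s hr hp hs hsp
    (netF N s (p * 2 ^ J)) (fun x i => ∑ j, a i j * x j)
    (fun at' i => ∑ j, a i j * avec (Real.sqrt (2 * s)) at' j) (avec (Real.sqrt (2 * s)))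
    K (m * (1 + 3 * Z)) hK (by positivity) ?_ ?_ ?_ ?_ ?_ y hy0 hy
  · have hc : (Fintype.card (Atm N) : ℝ) = 4 * N + 1 := by
      simp [Atm]; ring
    rw [hc] at key
    exact key
  · rintro (_ | ⟨j, b, c⟩) i
    · simp [avec]; positivity
    · rw [hav]
      have := hb j i
      gcongr
  · rintro (_ | ⟨j, b, c⟩)
    · simp [avec]; positivity
    · simp only [hav]
      rw [← Finset.mul_sum]
      have := hcol j
      gcongr
  · intro x hx
    obtain ⟨⟨b, hb⟩, -, -⟩ := mem_netF.1 hx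
    refine ⟨b, hb.symm, ?_⟩
    ext i
    rw [← hb]
    simp only [av, Finset.mul_sum]
    rw [Finset.sum_comm]
    refine Finset.sum_congr rfl fun l _ => Finset.sum_congr rfl fun j _ => by ring
  · intro x hx i
    obtain ⟨-, ⟨S, hS, hxS⟩, h1⟩ := mem_netF.1 hx
    refine (lin_sq_le S (a i) x hxS).trans ?_
    have h2 : ∑ j ∈ S, ‖a i j‖ ^ 2 ≤ s * K ^ 2 := by
      calc ∑ j ∈ S, ‖a i j‖ ^ 2 ≤ ∑ j ∈ S, K ^ 2 := Finset.sum_le_sum fun j _ => hb j i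
        _ = S.card * K ^ 2 := by simp
        _ ≤ _ := by gcongr
    calc _ ≤ (s * K ^ 2) * 1 := by gcongr
      _ = _ := by ring
  · intro x hx
    have h := (abs_le.1 (hZ x hx)).2
    have h1 := (mem_netF.1 hx).2.2
    rw [qf] at h
    have h4 : (∑ i, ‖∑ j, a i j * x j‖ ^ 2) / m ≤ 1 + 3 * Z := by linarith
    rw [div_le_iff₀ (by linarith)] at h4
    linarith

/-- maximum of absolute values over a finite set of functions -/
noncomputable def tsup {α X : Type*} (T : Finset α) (hT : T.Nonempty) (F : α → X → ℝ) (t : X) : ℝ :=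
  T.sup' hT (fun x => |F x t|)

lemma le_tsup {α X : Type*} {T : Finset α} (hT : T.Nonempty) (F : α → X → ℝ) (t : X) {x : α}
    (hx : x ∈ T) : |F x t| ≤ tsup T hT F t :=
  Finset.le_sup' (fun x => |F x t|) hx

lemma tsup_le {α X : Type*} {T : Finset α} (hT : T.Nonempty) (F : α → X → ℝ) (t : X) {b : ℝ}
    (h : ∀ x ∈ T, |F x t| ≤ b) : tsup T hT F t ≤ b :=
  Finset.sup'_le hT _ h

lemma tsup_nonneg {α X : Type*} {T : Finset α} (hT : T.Nonempty) (F : α → X → ℝ) (t : X) :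
    0 ≤ tsup T hT F t := by
  obtain ⟨x, hx⟩ := id hT
  exact (abs_nonneg _).trans (le_tsup hT F t hx)

lemma tsup_exists {α X : Type*} {T : Finset α} (hT : T.Nonempty) (F : α → X → ℝ) (t : X) :
    ∃ x ∈ T, tsup T hT F t = |F x t| :=
  Finset.exists_mem_eq_sup' hT (fun x => |F x t|)

lemma tsup_meas {α X : Type*} [MeasurableSpace X] {T : Finset α} (hT : T.Nonempty) (F : α → X → ℝ)
    (hF : ∀ x, Measurable (F x)) : Measurable (tsup T hT F) := by
  have h : tsup T hT F = T.sup' hT (fun x t => |F x t|) := by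
    ext t; simp [tsup, Finset.sup'_apply]
  rw [h]
  exact Finset.measurable_sup' hT (fun x _ => (hF x).abs)

lemma tsup_int {α X : Type*} [MeasurableSpace X] (μ : Measure X) [IsFiniteMeasure μ]
    {T : Finset α} (hT : T.Nonempty) (F : α → X → ℝ)
    (hF : ∀ x, Measurable (F x)) (B : ℝ) (hB : ∀ x t, |F x t| ≤ B) (q : ℕ) :
    Integrable (fun t => tsup T hT F t ^ q) μ := by
  refine Integrable.of_bound ((tsup_meas hT F hF).pow_const q).aestronglyMeasurable (B ^ q) ?_
  refine Filter.Eventually.of_forall fun t => ?_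
  have h0 := tsup_nonneg hT F t
  rw [Real.norm_eq_abs, abs_of_nonneg (by positivity)]
  exact pow_le_pow_left₀ h0 (tsup_le hT F t fun x _ => hB x t) q

/-- coordinatewise swap of two samples -/
def cswap {D : Type*} {m : ℕ} (e : Fin m → Bool) (u : (Fin m → D) × (Fin m → D)) :
    (Fin m → D) × (Fin m → D) :=
  (fun i => if e i then u.1 i else u.2 i, fun i => if e i then u.2 i else u.1 i)

lemma cswap_mp {D : Type*} [MeasurableSpace D] (ν : Measure D) [IsProbabilityMeasure ν] {m : ℕ}
    (e : Fin m → Bool) :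
    MeasurePreserving (cswap e)
      ((Measure.pi fun _ : Fin m => ν).prod (Measure.pi fun _ : Fin m => ν))
      ((Measure.pi fun _ : Fin m => ν).prod (Measure.pi fun _ : Fin m => ν)) := by
  have h1 := measurePreserving_arrowProdEquivProdArrow D D (Fin m) (fun _ => ν) (fun _ => ν)
  have h2 := measurePreserving_pi (fun _ : Fin m => ν.prod ν) (fun _ : Fin m => ν.prod ν)
    (f := fun i => if e i then id else Prod.swap) (by
      intro i
      split_ifs
      · exact MeasurePreserving.id _
      · exact Measure.measurePreserving_swap)
  have h3 := (h1.comp h2).comp (h1.symm)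
  convert h3 using 1
  ext u i
  · simp only [cswap, Function.comp]
    simp only [MeasurableEquiv.arrowProdEquivProdArrow]
    by_cases h : e i <;> simp [h, Equiv.arrowProdEquivProdArrow]
  · simp only [cswap, Function.comp]
    simp only [MeasurableEquiv.arrowProdEquivProdArrow]
    by_cases h : e i <;> simp [h, Equiv.arrowProdEquivProdArrow]

lemma jensen_pow {X : Type*} [MeasurableSpace X] (μ : Measure X) [IsProbabilityMeasure μ]
    (f : X → ℝ) (q : ℕ) (h0 : ∀ x, 0 ≤ f x) (hf : Integrable f μ)
    (hfq : Integrable (fun x => f x ^ q) μ) : (∫ x, f x ∂μ) ^ q ≤ ∫ x, f x ^ q ∂μ := by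
  have := (convexOn_pow (𝕜 := ℝ) q).map_integral_le (μ := μ) (f := f) (by fun_prop) isClosed_Ici
    (Filter.Eventually.of_forall h0) hf hfq
  simpa using this

lemma symm_ineq {α D : Type*} [MeasurableSpace D] (ν : Measure D) [IsProbabilityMeasure ν] {m : ℕ}
    (T : Finset α) (hT : T.Nonempty) (g : α → D → ℝ) (hg : ∀ x, Measurable (g x)) (B : ℝ)
    (hB : ∀ x d, |g x d| ≤ B) (q : ℕ) (hq : 1 ≤ q) (e : Fin m → Bool) :
    ∫ t, tsup T hT (fun x (t : Fin m → D) => ∑ i, (g x (t i) - ∫ d, g x d ∂ν)) t ^ q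
        ∂(Measure.pi fun _ : Fin m => ν) ≤
      2 ^ q * ∫ t, tsup T hT (fun x (t : Fin m → D) => ∑ i, rsg (e i) * g x (t i)) t ^ q
        ∂(Measure.pi fun _ : Fin m => ν) := by
  set μ := Measure.pi fun _ : Fin m => ν with hμ
  set G : α → (Fin m → D) × (Fin m → D) → ℝ := fun x u => ∑ i, (g x (u.1 i) - g x (u.2 i)) with hG
  set H : α → (Fin m → D) → ℝ := fun x (t : Fin m → D) => ∑ i, rsg (e i) * g x (t i) with hH
  have hgi : ∀ x, ∀ i : Fin m, Measurable fun t : Fin m → D => g x (t i) :=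
    fun x i => (hg x).comp (measurable_pi_apply i)
  have hGm : ∀ x, Measurable (G x) := fun x => Finset.measurable_sum _ fun i _ =>
    ((hgi x i).comp measurable_fst).sub ((hgi x i).comp measurable_snd)
  have hrs : ∀ b, |rsg b| = 1 := fun b => by cases b <;> simp [rsg]
  have hGB : ∀ x u, |G x u| ≤ m * (2 * B) := fun x u => by
    calc |G x u| ≤ ∑ i : Fin m, |g x (u.1 i) - g x (u.2 i)| := Finset.abs_sum_le_sum_abs _ _
      _ ≤ ∑ i : Fin m, 2 * B := Finset.sum_le_sum fun i _ => by
          have := abs_sub (g x (u.1 i)) (g x (u.2 i))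
          linarith [hB x (u.1 i), hB x (u.2 i)]
      _ = _ := by simp
  have hHm : ∀ x, Measurable (H x) := fun x => Finset.measurable_sum _ fun i _ =>
    (hgi x i).const_mul _
  have hHB : ∀ x u, |H x u| ≤ m * B := fun x u => by
    calc |H x u| ≤ ∑ i : Fin m, |rsg (e i) * g x (u i)| := Finset.abs_sum_le_sum_abs _ _
      _ ≤ ∑ i : Fin m, B := Finset.sum_le_sum fun i _ => by
          rw [abs_mul, hrs, one_mul]; exact hB _ _
      _ = _ := by simp
  -- pointwise Jensen
  have hGt : ∀ t, ∀ x, Measurable (fun t' => G x (t, t')) := fun t x =>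
    (hGm x).comp measurable_prodMk_left
  have step1 : ∀ t, tsup T hT (fun x (t : Fin m → D) => ∑ i, (g x (t i) - ∫ d, g x d ∂ν)) t ^ q ≤
      ∫ t', tsup T hT G (t, t') ^ q ∂μ := by
    intro t
    have hi1 := tsup_int μ hT (fun x t' => G x (t, t')) (hGt t) _ (fun x t' => hGB x _) 1
    have hiq := tsup_int μ hT (fun x t' => G x (t, t')) (hGt t) _ (fun x t' => hGB x _) q
    simp only [pow_one] at hi1
    refine le_trans (pow_le_pow_left₀ (tsup_nonneg _ _ _) ?_ q)
      (jensen_pow μ _ q (fun t' => tsup_nonneg hT (fun x t' => G x (t, t')) t') hi1 hiq)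
    refine tsup_le _ _ _ fun x hx => ?_
    have hint : ∀ i : Fin m, Integrable (fun t' : Fin m → D => g x (t' i)) μ := fun i =>
      Integrable.of_bound (hgi x i).aestronglyMeasurable B
        (Filter.Eventually.of_forall fun t' => hB _ _)
    have he : ∑ i, (g x (t i) - ∫ d, g x d ∂ν) = ∫ t', G x (t, t') ∂μ := by
      simp only [hG]
      have hint2 : ∀ i ∈ (Finset.univ : Finset (Fin m)),
          Integrable (fun t' : Fin m → D => g x (t i) - g x (t' i)) μ :=
        fun i _ => (integrable_const _).sub (hint i)
      rw [integral_finsetSum _ hint2]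
      refine Finset.sum_congr rfl fun i _ => ?_
      rw [integral_sub (integrable_const _) (hint i)]
      congr 1
      · simp
      · have := (measurePreserving_eval (fun _ : Fin m => ν) i).map_eq
        conv_lhs => rw [← this]
        rw [integral_map (measurable_pi_apply i).aemeasurable]
        · exact (hg x).aestronglyMeasurable
    rw [he]
    refine (abs_integral_le_integral_abs).trans ?_
    refine integral_mono_of_nonneg (Filter.Eventually.of_forall fun t' => abs_nonneg _) hi1
      (Filter.Eventually.of_forall fun t' => le_tsup hT (fun x t' => G x (t, t')) t' hx)
  have hGint := tsup_int (μ.prod μ) hT G hGm _ hGB q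
  have step2 : ∫ t, tsup T hT (fun x (t : Fin m → D) => ∑ i, (g x (t i) - ∫ d, g x d ∂ν)) t ^ q ∂μ
      ≤ ∫ u, tsup T hT G u ^ q ∂(μ.prod μ) := by
    rw [integral_prod _ hGint]
    exact integral_mono_of_nonneg (Filter.Eventually.of_forall fun t =>
      pow_nonneg (tsup_nonneg _ _ _) _) hGint.integral_prod_left (Filter.Eventually.of_forall step1)
  have step3 : ∫ u, tsup T hT G u ^ q ∂(μ.prod μ) = ∫ u, tsup T hT G (cswap e u) ^ q ∂(μ.prod μ) := by
    have h := cswap_mp ν e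
    conv_lhs => rw [← h.map_eq]
    rw [integral_map h.measurable.aemeasurable]
    exact ((tsup_meas hT G hGm).pow_const q).aestronglyMeasurable
  have hHint := tsup_int μ hT H hHm _ hHB q
  have hpt : ∀ u, tsup T hT G (cswap e u) ^ q ≤
      2 ^ (q - 1) * (tsup T hT H u.1 ^ q + tsup T hT H u.2 ^ q) := by
    intro u
    refine le_trans (pow_le_pow_left₀ (tsup_nonneg _ _ _) ?_ q)
      (add_pow_le (tsup_nonneg _ _ _) (tsup_nonneg _ _ _) q)
    refine tsup_le _ _ _ fun x hx => ?_
    have he : G x (cswap e u) = H x u.1 - H x u.2 := by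
      simp only [hG, hH, ← Finset.sum_sub_distrib]
      refine Finset.sum_congr rfl fun i _ => ?_
      by_cases h : e i <;> simp [h, cswap, rsg] <;> ring
    rw [he]
    exact (abs_sub _ _).trans (add_le_add (le_tsup hT H _ hx) (le_tsup hT H _ hx))
  have hi1 : Integrable (fun u : (Fin m → D) × (Fin m → D) => tsup T hT H u.1 ^ q) (μ.prod μ) :=
    hHint.comp_fst μ
  have hi2 : Integrable (fun u : (Fin m → D) × (Fin m → D) => tsup T hT H u.2 ^ q) (μ.prod μ) :=
    hHint.comp_snd μ
  have e1 : ∫ u : (Fin m → D) × (Fin m → D), tsup T hT H u.1 ^ q ∂(μ.prod μ)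
      = ∫ t, tsup T hT H t ^ q ∂μ := by
    rw [integral_fun_fst (μ := μ) (ν := μ) (fun t => tsup T hT H t ^ q)]; simp
  have e2 : ∫ u : (Fin m → D) × (Fin m → D), tsup T hT H u.2 ^ q ∂(μ.prod μ)
      = ∫ t, tsup T hT H t ^ q ∂μ := by
    rw [integral_fun_snd (μ := μ) (ν := μ) (fun t => tsup T hT H t ^ q)]; simp
  rw [step3] at step2
  refine step2.trans ?_
  refine (integral_mono_of_nonneg (Filter.Eventually.of_forall fun t =>
      pow_nonneg (tsup_nonneg _ _ _) _) ((hi1.add hi2).const_mul _)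
      (Filter.Eventually.of_forall hpt)).trans ?_
  simp only [Pi.add_apply]
  rw [integral_const_mul, integral_add hi1 hi2, e1, e2]
  obtain ⟨q', rfl⟩ : ∃ q', q = q' + 1 := ⟨q - 1, by omega⟩
  rw [Nat.add_sub_cancel, pow_succ]
  apply le_of_eq; ring

lemma int_nsq {D : Type*} [MeasurableSpace D] (ν : Measure D) [IsProbabilityMeasure ν] {N : ℕ}
    (φ : Fin N → D → ℂ) (K : ℝ) (hφ : ∀ j, Measurable (φ j))
    (ho : ∀ i j, ∫ ξ, φ i ξ * (starRingEnd ℂ) (φ j ξ) ∂ν = if i = j then 1 else 0)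
    (hb : ∀ j ξ, ‖φ j ξ‖ ≤ K) (x : Fin N → ℂ) :
    ∫ d, ‖∑ j, φ j d * x j‖ ^ 2 ∂ν = ∑ j, ‖x j‖ ^ 2 := by
  have hint : ∀ i j, Integrable (fun d => φ i d * (starRingEnd ℂ) (φ j d)) ν := by
    intro i j
    refine Integrable.of_bound ((hφ i).mul
      (Complex.continuous_conj.measurable.comp (hφ j))).aestronglyMeasurable (K * K) ?_
    refine Filter.Eventually.of_forall fun d => ?_
    rw [norm_mul, RCLike.norm_conj]
    exact mul_le_mul (hb i d) (hb j d) (norm_nonneg _) ((norm_nonneg _).trans (hb i d))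
  have h1 : ∀ d, ((‖∑ j, φ j d * x j‖ ^ 2 : ℝ) : ℂ) =
      ∑ i, ∑ j, (x i * (starRingEnd ℂ) (x j)) * (φ i d * (starRingEnd ℂ) (φ j d)) := by
    intro d
    push_cast
    rw [← Complex.mul_conj', map_sum, Finset.sum_mul_sum]
    refine Finset.sum_congr rfl fun i _ => Finset.sum_congr rfl fun j _ => ?_
    rw [map_mul]; ring
  apply Complex.ofReal_injective
  rw [← integral_complex_ofReal]
  simp only [h1]
  have hi2 : ∀ i ∈ (Finset.univ : Finset (Fin N)), Integrable (fun d => ∑ j,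
      (x i * (starRingEnd ℂ) (x j)) * (φ i d * (starRingEnd ℂ) (φ j d))) ν :=
    fun i _ => integrable_finsetSum _ fun j _ => (hint i j).const_mul _
  rw [integral_finsetSum _ hi2]
  push_cast
  refine Finset.sum_congr rfl fun i _ => ?_
  rw [integral_finsetSum _ fun j _ => (hint i j).const_mul _]
  simp only [integral_const_mul, ho]
  simp [← Complex.mul_conj']

lemma moment_main {D : Type*} [MeasurableSpace D] (ν : Measure D) [IsProbabilityMeasure ν]
    {N m : ℕ} (φ : Fin N → D → ℂ) (K : ℝ) (hK : 0 < K) (hφ : ∀ j, Measurable (φ j))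
    (ho : ∀ i j, ∫ ξ, φ i ξ * (starRingEnd ℂ) (φ j ξ) ∂ν = if i = j then 1 else 0)
    (hb : ∀ j ξ, ‖φ j ξ‖ ≤ K) (r J p s : ℕ) (hm : 1 ≤ m) (hr : 1 ≤ r) (hp : 1 ≤ p) (hs : 1 ≤ s)
    (hsp : (s:ℝ) ≤ 3 ^ p) (hJ : 8 * s ≤ p * 2 ^ J) :
    ∃ Z : (Fin m → D) → ℝ, Measurable Z ∧ (∀ t, 0 ≤ Z t) ∧ (∃ B, ∀ t, Z t ≤ B) ∧
      (∀ t, ∀ z ∈ netF N s (p * 2 ^ J), |qf (fun i j => φ j (t i)) z| ≤ Z t) ∧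
      ∫ t, Z t ^ (2 * r) ∂(Measure.pi fun _ : Fin m => ν) ≤
        (4 * (72 * 294912 * s * K ^ 2 *
          (16 * r + (J + 1) ^ 2 * (2 * p * Real.log (4 * N + 1)))) / m) ^ r *
        ∫ t, (1 + 3 * Z t) ^ r ∂(Measure.pi fun _ : Fin m => ν) := by
  set n := p * 2 ^ J with hn
  set μ := Measure.pi fun _ : Fin m => ν with hμ
  set L : ℝ := 16 * r + (J + 1) ^ 2 * (2 * p * Real.log (4 * N + 1)) with hL
  have hL0 : 0 ≤ L := by
    have : 0 ≤ Real.log (4 * (N:ℝ) + 1) := Real.log_nonneg (by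
      have : (0:ℝ) ≤ N := by positivity
      linarith)
    positivity
  have hm' : (1:ℝ) ≤ m := by exact_mod_cast hm
  have hm0 : (0:ℝ) < m := by linarith
  let g : ↥(netF N s n) → D → ℝ := fun x d => ‖∑ j, φ j d * x.1 j‖ ^ 2
  have hT : (Finset.univ : Finset ↥(netF N s n)).Nonempty := ⟨⟨0, zero_mem_netF N s n⟩, by simp⟩
  have hgm : ∀ x, Measurable (g x) := fun x =>
    (Measurable.norm (Finset.measurable_sum _ fun j _ => (hφ j).mul_const _)).pow_const 2
  have hgB : ∀ x d, |g x d| ≤ s * K ^ 2 := by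
    rintro ⟨x, hx⟩ d
    obtain ⟨-, ⟨S, hS, hxS⟩, h1⟩ := mem_netF.1 hx
    have hg0 : |g ⟨x, hx⟩ d| = ‖∑ j, φ j d * x j‖ ^ 2 := abs_of_nonneg (by positivity)
    rw [hg0]
    refine (lin_sq_le S (fun j => φ j d) x hxS).trans ?_
    have h2 : ∑ j ∈ S, ‖φ j d‖ ^ 2 ≤ s * K ^ 2 := by
      calc ∑ j ∈ S, ‖φ j d‖ ^ 2 ≤ ∑ j ∈ S, K ^ 2 := Finset.sum_le_sum fun j _ => by
            have := hb j d; gcongr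
        _ = S.card * K ^ 2 := by simp
        _ ≤ _ := by gcongr
    calc _ ≤ (s * K ^ 2) * 1 := by gcongr
      _ = _ := by ring
  have hgI : ∀ x, ∫ d, g x d ∂ν = ∑ j, ‖x.1 j‖ ^ 2 := fun x => int_nsq ν φ K hφ ho hb x.1
  let F : ↥(netF N s n) → (Fin m → D) → ℝ := fun x t => ∑ i, (g x (t i) - ∫ d, g x d ∂ν)
  let H : (Fin m → Bool) → ↥(netF N s n) → (Fin m → D) → ℝ :=
    fun e x t => ∑ i, rsg (e i) * g x (t i)
  have hgi : ∀ x, ∀ i : Fin m, Measurable fun t : Fin m → D => g x (t i) :=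
    fun x i => (hgm x).comp (measurable_pi_apply i)
  have hFm : ∀ x, Measurable (F x) := fun x => Finset.measurable_sum _ fun i _ =>
    (hgi x i).sub_const _
  have hHm : ∀ e x, Measurable (H e x) := fun e x => Finset.measurable_sum _ fun i _ =>
    (hgi x i).const_mul _
  have hrs : ∀ b, |rsg b| = 1 := fun b => by cases b <;> simp [rsg]
  have hHB : ∀ e x u, |H e x u| ≤ m * (s * K ^ 2) := fun e x u => by
    calc |H e x u| ≤ ∑ i : Fin m, |rsg (e i) * g x (u i)| := Finset.abs_sum_le_sum_abs _ _
      _ ≤ ∑ i : Fin m, s * K ^ 2 := Finset.sum_le_sum fun i _ => by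
          rw [abs_mul, hrs, one_mul]; exact hgB _ _
      _ = _ := by simp
  have hFB : ∀ x u, |F x u| ≤ m * (s * K ^ 2 + 1) := fun x u => by
    calc |F x u| ≤ ∑ i : Fin m, |g x (u i) - ∫ d, g x d ∂ν| := Finset.abs_sum_le_sum_abs _ _
      _ ≤ ∑ i : Fin m, (s * K ^ 2 + 1) := Finset.sum_le_sum fun i _ => by
          refine (abs_sub _ _).trans (add_le_add (hgB _ _) ?_)
          rw [hgI, abs_of_nonneg (by positivity)]
          exact (mem_netF.1 x.2).2.2
      _ = _ := by simp; ring
  have hqf : ∀ (t : Fin m → D) (x : ↥(netF N s n)), qf (fun i j => φ j (t i)) x.1 = F x t / m := by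
    intro t x
    simp only [F, Finset.sum_sub_distrib, hgI, qf, g]
    rw [sub_div]
    congr 1
    simp only [Finset.sum_const, Finset.card_univ, Fintype.card_fin, nsmul_eq_mul]
    field_simp
  have hV := tsup_meas hT F hFm
  have hZq : ∀ t, ∀ z ∈ netF N s n, |qf (fun i j => φ j (t i)) z| ≤ tsup Finset.univ hT F t / m := by
    intro t z hz
    rw [hqf t ⟨z, hz⟩, abs_div, abs_of_pos hm0]
    have := le_tsup hT F t (Finset.mem_univ ⟨z, hz⟩)
    gcongr
  refine ⟨fun t => tsup Finset.univ hT F t / m, hV.div_const _,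
    fun t => div_nonneg (tsup_nonneg _ _ _) hm0.le, ⟨m * (s * K ^ 2 + 1) / m, fun t => ?_⟩, hZq, ?_⟩
  · exact div_le_div_of_nonneg_right (tsup_le hT F t fun x _ => hFB x t) hm0.le
  -- main inequality
  have hpt : ∀ t, ∑ e, tsup Finset.univ hT (H e) t ^ (2 * r) ≤ 2 ^ m *
      (72 * (294912 * s * K ^ 2 * (m * (1 + 3 * (tsup Finset.univ hT F t / m)))) * L) ^ r := by
    intro t
    refine cond_spec r J p s hm hr hp hs hsp hJ (fun i j => φ j (t i)) K _ hK
      (fun i j => hb j (t i)) (hZq t) _ (fun e => tsup_nonneg _ _ _) fun e => ?_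
    obtain ⟨x, -, hx⟩ := tsup_exists hT (H e) t
    exact ⟨x.1, x.2, hx.le⟩
  have hs1 : ∀ e, ∫ t, tsup Finset.univ hT F t ^ (2 * r) ∂μ ≤
      2 ^ (2 * r) * ∫ t, tsup Finset.univ hT (H e) t ^ (2 * r) ∂μ := fun e =>
    symm_ineq ν Finset.univ hT g hgm _ hgB (2 * r) (by omega) e
  have hs2 := Finset.sum_le_sum (s := (Finset.univ : Finset (Fin m → Bool))) fun e _ => hs1 e
  rw [← Finset.mul_sum, ← integral_finsetSum _ fun e _ =>
    tsup_int μ hT (H e) (hHm e) _ (hHB e) _] at hs2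
  simp only [Finset.sum_const, Finset.card_univ, Fintype.card_pi, Fintype.card_bool,
    Finset.prod_const, Fintype.card_fin, nsmul_eq_mul, Nat.cast_pow, Nat.cast_ofNat] at hs2
  set C : ℝ := 72 * 294912 * s * K ^ 2 * L with hC
  have hint1 : Integrable (fun t => (1 + 3 * (tsup Finset.univ hT F t / m)) ^ r) μ := by
    refine Integrable.of_bound (((hV.div_const _).const_mul 3).const_add 1
      |>.pow_const r).aestronglyMeasurable ((1 + 3 * (m * (s * K ^ 2 + 1) / m)) ^ r) ?_
    refine Filter.Eventually.of_forall fun t => ?_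
    have h0 := tsup_nonneg hT F t
    rw [Real.norm_eq_abs, abs_of_nonneg (by positivity)]
    have := tsup_le hT F t fun x _ => hFB x t
    gcongr
  have hs3 : ∫ t, ∑ e, tsup Finset.univ hT (H e) t ^ (2 * r) ∂μ ≤
      2 ^ m * ((C * m) ^ r * ∫ t, (1 + 3 * (tsup Finset.univ hT F t / m)) ^ r ∂μ) := by
    rw [← integral_const_mul, ← integral_const_mul]
    refine integral_mono_of_nonneg (Filter.Eventually.of_forall fun t =>
      Finset.sum_nonneg fun e _ => pow_nonneg (tsup_nonneg _ _ _) _)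
      ((hint1.const_mul _).const_mul _) (Filter.Eventually.of_forall fun t => ?_)
    refine (hpt t).trans (le_of_eq ?_)
    dsimp only
    rw [← mul_pow]
    congr 2
    rw [hC]; ring
  have hs4 : ∫ t, tsup Finset.univ hT F t ^ (2 * r) ∂μ ≤
      2 ^ (2 * r) * ((C * m) ^ r * ∫ t, (1 + 3 * (tsup Finset.univ hT F t / m)) ^ r ∂μ) := by
    have h2 : (0:ℝ) < 2 ^ m := by positivity
    refine le_of_mul_le_mul_left (hs2.trans ?_) h2
    calc _ ≤ _ := mul_le_mul_of_nonneg_left hs3 (by positivity)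
      _ = _ := by ring
  simp only [div_pow]
  rw [integral_div, div_le_iff₀ (by positivity)]
  refine hs4.trans (le_of_eq ?_)
  generalize (∫ t, (1 + 3 * (tsup Finset.univ hT F t / m)) ^ r ∂μ) = I
  have e1 : (m:ℝ) ^ (2 * r) = m ^ r * m ^ r := by rw [two_mul, pow_add]
  have e2 : (2:ℝ) ^ (2 * r) = 4 ^ r := by rw [pow_mul]; norm_num
  rw [e1, e2, mul_pow C, mul_pow 4 C]
  field_simp

lemma l2sq {n : ℕ} (x : Fin n → ℂ) : l2norm x ^ 2 = ∑ i, ‖x i‖ ^ 2 := by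
  rw [l2norm, Real.sq_sqrt (by positivity)]

lemma nsq_add_bd (w c : ℂ) (δ : ℝ) (hδ : 0 < δ) :
    |‖w + c‖ ^ 2 - ‖w‖ ^ 2 - ‖c‖ ^ 2| ≤ 2 / δ * ‖w‖ ^ 2 + δ / 2 * ‖c‖ ^ 2 := by
  have h1 : ‖w + c‖ ^ 2 - ‖w‖ ^ 2 - ‖c‖ ^ 2 = 2 * (w * (starRingEnd ℂ) c).re := by
    simp only [Complex.sq_norm, Complex.normSq_apply]
    simp
    ring
  have h2 := Complex.abs_re_le_norm (w * (starRingEnd ℂ) c)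
  rw [norm_mul, RCLike.norm_conj] at h2
  rw [h1, abs_mul, abs_two]
  have h3 : 2 / δ * ‖w‖ ^ 2 + δ / 2 * ‖c‖ ^ 2 - 2 * (‖w‖ * ‖c‖) =
      (2 * ‖w‖ - δ * ‖c‖) ^ 2 / (2 * δ) := by
    field_simp; ring
  have h4 : 0 ≤ (2 * ‖w‖ - δ * ‖c‖) ^ 2 / (2 * δ) := by positivity
  linarith

lemma det_rip {m N : ℕ} (s k : ℕ) (K δ : ℝ) (hm : 1 ≤ m) (hk : 1 ≤ k) (hδ : 0 < δ)
    (a : Fin m → Fin N → ℂ) (ha : ∀ i j, ‖a i j‖ ≤ K)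
    (hq : ∀ x, IsSparse s x → |qf a x| ≤ δ / 2 * ∑ j, ‖x j‖ ^ 2)
    (hmk : (m : ℝ) ≥ 8 * δ⁻¹ ^ 2 * K ^ 2 * s * k) :
    RIPCor (Matrix.of fun i j => ((Real.sqrt (m : ℝ) : ℂ))⁻¹ * a i j) s k δ := by
  have hm0 : (0:ℝ) < m := by exact_mod_cast hm
  have hk0 : (0:ℝ) < k := by exact_mod_cast hk
  intro x c hx hc
  have hqx := hq x hx
  obtain ⟨S, hS, hxS⟩ := hx
  obtain ⟨T, hT, hcT⟩ := hc
  rw [l2sq, l2sq, l2sq]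
  set X := ∑ j, ‖x j‖ ^ 2 with hX
  have hX0 : 0 ≤ X := by positivity
  set C := ∑ j, ‖c j‖ ^ 2 with hC
  have hC0 : 0 ≤ C := by positivity
  set A : Matrix (Fin m) (Fin N) ℂ := Matrix.of fun i j => ((Real.sqrt (m : ℝ) : ℂ))⁻¹ * a i j with hA
  have hw : ∀ i, A.mulVec x i = ((Real.sqrt (m : ℝ) : ℂ))⁻¹ * ∑ j, a i j * x j := by
    intro i
    simp only [hA, Matrix.mulVec, dotProduct, Matrix.of_apply, Finset.mul_sum, mul_assoc]
  have hw2 : ∀ i, ‖A.mulVec x i‖ ^ 2 = ‖∑ j, a i j * x j‖ ^ 2 / m := by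
    intro i
    rw [hw, norm_mul, mul_pow, norm_inv, Complex.norm_real, Real.norm_eq_abs, inv_pow, sq_abs,
      Real.sq_sqrt hm0.le]
    ring
  have hqf : qf a x = ∑ i, ‖A.mulVec x i‖ ^ 2 - X := by
    rw [qf]; simp only [hw2, ← Finset.sum_div, ← hX]
  have hwb : ∀ i, ‖A.mulVec x i‖ ^ 2 ≤ δ ^ 2 * X / (8 * k) := by
    intro i
    have h1 := lin_sq_le S (a i) x hxS
    have h2 : ∑ j ∈ S, ‖a i j‖ ^ 2 ≤ s * K ^ 2 := by
      calc ∑ j ∈ S, ‖a i j‖ ^ 2 ≤ ∑ j ∈ S, K ^ 2 := Finset.sum_le_sum fun j _ => by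
            have := ha i j; gcongr
        _ = S.card * K ^ 2 := by simp
        _ ≤ _ := by gcongr
    rw [hw2, div_le_div_iff₀ hm0 (by positivity)]
    have h3 : 8 * K ^ 2 * s * k ≤ δ ^ 2 * m := by
      have : δ ^ 2 * (8 * δ⁻¹ ^ 2 * K ^ 2 * s * k) ≤ δ ^ 2 * m := by gcongr
      refine le_trans (le_of_eq ?_) this
      field_simp
    calc _ ≤ (s * K ^ 2 * X) * (8 * k) := by
            gcongr
            exact h1.trans (by gcongr)
      _ = X * (8 * K ^ 2 * s * k) := by ring
      _ ≤ X * (δ ^ 2 * m) := by gcongr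
      _ = _ := by ring
  have hcross : |∑ i, ‖(A.mulVec x + c) i‖ ^ 2 - ∑ i, ‖A.mulVec x i‖ ^ 2 - C| ≤
      δ / 4 * X + δ / 2 * C := by
    rw [hC, ← Finset.sum_sub_distrib, ← Finset.sum_sub_distrib]
    refine (Finset.abs_sum_le_sum_abs _ _).trans ?_
    have h1 : ∀ i, |‖(A.mulVec x + c) i‖ ^ 2 - ‖A.mulVec x i‖ ^ 2 - ‖c i‖ ^ 2| ≤
        (if i ∈ T then δ * X / (4 * k) else 0) + δ / 2 * ‖c i‖ ^ 2 := by
      intro i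
      rw [Pi.add_apply]
      split_ifs with hi
      · refine (nsq_add_bd _ _ δ hδ).trans ?_
        gcongr
        calc 2 / δ * ‖A.mulVec x i‖ ^ 2 ≤ 2 / δ * (δ ^ 2 * X / (8 * k)) := by
              have := hwb i; gcongr
          _ = _ := by field_simp; ring
      · simp [hcT i hi]
    refine (Finset.sum_le_sum fun i _ => h1 i).trans ?_
    rw [Finset.sum_add_distrib, ← Finset.mul_sum]
    gcongr
    rw [Finset.sum_ite_mem, Finset.univ_inter, Finset.sum_const, nsmul_eq_mul]
    have : (T.card : ℝ) ≤ k := by exact_mod_cast hT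
    calc (T.card : ℝ) * (δ * X / (4 * k)) ≤ k * (δ * X / (4 * k)) := by gcongr
      _ = _ := by field_simp
  rw [hqf] at hqx
  have a1 := abs_le.1 hqx
  have a2 := abs_le.1 hcross
  have b1 : 0 ≤ δ * X := by positivity
  have b2 : 0 ≤ δ * C := by positivity
  constructor
  · linarith [a1.1, a2.1]
  · linarith [a1.2, a2.2]

lemma tail_bd {X : Type*} [MeasurableSpace X] (μ : Measure X) [IsProbabilityMeasure μ]
    (Z : X → ℝ) (hZm : Measurable Z) (hZ0 : ∀ t, 0 ≤ Z t) (B : ℝ) (hB : ∀ t, Z t ≤ B)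
    (r : ℕ) (hr : 1 ≤ r) (b δ ε : ℝ) (hb : 0 ≤ b) (hδ : 0 < δ) (hδ1 : δ < 1) (hε : 0 < ε)
    (hbδ : b ≤ δ ^ 2 / 216) (hrε : Real.log (1 / ε) ≤ r)
    (h : ∫ t, Z t ^ (2 * r) ∂μ ≤ b ^ r * ∫ t, (1 + 3 * Z t) ^ r ∂μ) :
    ENNReal.ofReal (1 - ε) ≤ μ {t | Z t ≤ δ / 6} := by
  have hint : ∀ q : ℕ, Integrable (fun t => Z t ^ q) μ := fun q => by
    refine Integrable.of_bound (hZm.pow_const q).aestronglyMeasurable (B ^ q) ?_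
    refine Filter.Eventually.of_forall fun t => ?_
    have h0 := hZ0 t
    rw [Real.norm_eq_abs, abs_of_nonneg (by positivity)]
    exact pow_le_pow_left₀ h0 (hB t) q
  set y := ∫ t, Z t ^ (2 * r) ∂μ with hy
  have hpt : ∀ t, b ^ r * (1 + 3 * Z t) ^ r ≤
      (1 / 2 * (2 * b) ^ r + 1 / 4 * (6 * b) ^ (2 * r)) + 1 / 4 * Z t ^ (2 * r) := by
    intro t
    have h0 := hZ0 t
    have h1 := add_pow_le (zero_le_one (α := ℝ)) (by positivity : 0 ≤ 3 * Z t) r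
    obtain ⟨q, rfl⟩ : ∃ q, r = q + 1 := ⟨r - 1, by omega⟩
    rw [Nat.add_sub_cancel, one_pow] at h1
    calc b ^ (q + 1) * (1 + 3 * Z t) ^ (q + 1)
        ≤ b ^ (q + 1) * (2 ^ q * (1 + (3 * Z t) ^ (q + 1))) := by gcongr
      _ = 1 / 2 * (2 * b) ^ (q + 1) + 1 / 2 * ((6 * b) ^ (q + 1) * Z t ^ (q + 1)) := by
          have : (6:ℝ) = 2 * 3 := by norm_num
          rw [this]
          simp only [mul_pow, pow_succ]; ring
      _ ≤ _ := by
          have h2 := sq_nonneg ((6 * b) ^ (q + 1) - Z t ^ (q + 1))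
          rw [mul_comm 2 (q + 1), pow_mul, pow_mul]
          nlinarith
  have hy1 : y ≤ (1 / 2 * (2 * b) ^ r + 1 / 4 * (6 * b) ^ (2 * r)) + 1 / 4 * y := by
    refine h.trans ?_
    rw [← integral_const_mul]
    refine (integral_mono_of_nonneg (Filter.Eventually.of_forall fun t => ?_)
      ((integrable_const _).add ((hint (2 * r)).const_mul (1/4)))
      (Filter.Eventually.of_forall hpt)).trans ?_
    · have := hZ0 t
      simp only [Pi.zero_apply]
      positivity
    · simp only [Pi.add_apply]
      rw [integral_add (integrable_const _) ((hint (2 * r)).const_mul (1/4)), integral_const_mul]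
      simp [hy]
  have hδ2 : δ ^ 2 ≤ 1 := by nlinarith
  have h6 : (6 * b) ^ (2 * r) ≤ (2 * b) ^ r := by
    rw [pow_mul]
    apply pow_le_pow_left₀ (by positivity)
    nlinarith
  have hy2 : y ≤ (2 * b) ^ r := by
    have : 0 ≤ (2 * b) ^ r := by positivity
    linarith
  -- Markov
  have hmk := mul_meas_ge_le_integral_of_nonneg (μ := μ) (f := fun t => Z t ^ (2 * r))
    (Filter.Eventually.of_forall fun t => pow_nonneg (hZ0 t) _) (hint (2 * r)) ((δ / 6) ^ (2 * r))
  have h3 : (3:ℝ)⁻¹ ^ r ≤ ε := by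
    have e1 : Real.exp (-(r:ℝ)) ≤ ε := by
      rw [← Real.le_log_iff_exp_le hε]
      rw [one_div, Real.log_inv] at hrε
      linarith
    refine le_trans ?_ e1
    have : Real.exp (-(r:ℝ)) = (Real.exp 1)⁻¹ ^ r := by
      rw [← Real.exp_neg, ← Real.exp_nat_mul]; ring_nf
    rw [this]
    have := Real.exp_one_lt_three
    gcongr
  have hms : MeasurableSet {t | Z t ≤ δ / 6} := measurableSet_le hZm measurable_const
  have hbad : μ.real {t | (δ / 6) ^ (2 * r) ≤ Z t ^ (2 * r)} ≤ ε := by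
    have hd : (0:ℝ) < (δ / 6) ^ (2 * r) := by positivity
    have : (δ / 6) ^ (2 * r) * μ.real {t | (δ / 6) ^ (2 * r) ≤ Z t ^ (2 * r)} ≤
        (δ / 6) ^ (2 * r) * ε := by
      refine hmk.trans (hy2.trans ?_)
      refine le_trans ?_ (mul_le_mul_of_nonneg_left h3 hd.le)
      rw [pow_mul, ← mul_pow]
      apply pow_le_pow_left₀ (by positivity)
      nlinarith
    exact le_of_mul_le_mul_left this hd
  have hc : μ.real {t | Z t ≤ δ / 6}ᶜ ≤ ε := by
    refine le_trans (measureReal_mono ?_) hbad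
    intro t ht
    simp only [Set.mem_compl_iff, Set.mem_setOf_eq, not_le] at ht ⊢
    exact pow_le_pow_left₀ (by positivity) ht.le _
  rw [probReal_compl_eq_one_sub hms] at hc
  rw [← ofReal_measureReal]
  exact ENNReal.ofReal_le_ofReal (by linarith)

lemma param_bd (s N : ℕ) (hs : 1 ≤ s) (hN : s ≤ N) (ε : ℝ) (hε : 0 < ε) (hε1 : ε < 1) :
    ∃ r J p : ℕ, 1 ≤ r ∧ 1 ≤ p ∧ (s:ℝ) ≤ 3 ^ p ∧ 8 * s ≤ p * 2 ^ J ∧ Real.log (1 / ε) ≤ r ∧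
      16 * (r:ℝ) + ((J:ℝ) + 1) ^ 2 * (2 * p * Real.log (4 * N + 1)) ≤
        2500 * (Real.log (2 * s) ^ 3 * Real.log (2 * N) + Real.log (1 / ε)) := by
  have hs' : (1:ℝ) ≤ s := by exact_mod_cast hs
  have hN' : (1:ℝ) ≤ N := by exact_mod_cast hs.trans hN
  have hl2 : (0.69:ℝ) ≤ Real.log 2 := by linarith [Real.log_two_gt_d9]
  set ls := Real.log (2 * s) with hls
  set lN := Real.log (2 * N) with hlN
  set le' := Real.log (1 / ε) with hle
  have h1 : (0.69:ℝ) ≤ ls := hl2.trans (Real.log_le_log (by norm_num) (by linarith))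
  have h2 : (0.69:ℝ) ≤ lN := hl2.trans (Real.log_le_log (by norm_num) (by linarith))
  have h3 : 0 < le' := Real.log_pos (by rw [lt_div_iff₀ hε]; linarith)
  set p := ⌈ls⌉₊ with hp
  have hp1 : 1 ≤ p := Nat.one_le_ceil_iff.2 (by linarith)
  have hp2 : (p:ℝ) ≤ 2.5 * ls := by
    have := Nat.ceil_lt_add_one (a := ls) (by linarith)
    linarith
  have hsp : (s:ℝ) ≤ 3 ^ p := by
    have e1 : Real.exp ls = 2 * s := Real.exp_log (by linarith)
    have e2 : Real.exp ls ≤ Real.exp p := Real.exp_le_exp.2 (Nat.le_ceil _)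
    have e3 : Real.exp p = Real.exp 1 ^ p := by rw [← Real.exp_nat_mul]; ring_nf
    have e4 : Real.exp 1 ^ p ≤ 3 ^ p := pow_le_pow_left₀ (Real.exp_pos _).le Real.exp_one_lt_three.le _
    linarith
  refine ⟨⌈le'⌉₊, 3 + 2 * p, p, Nat.one_le_ceil_iff.2 h3, hp1, hsp, ?_, Nat.le_ceil _, ?_⟩
  · have hsp' : s ≤ 3 ^ p := by exact_mod_cast hsp
    have : 3 ^ p ≤ 4 ^ p := Nat.pow_le_pow_left (by norm_num) p
    calc 8 * s ≤ 1 * (8 * 4 ^ p) := by omega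
      _ ≤ p * (8 * 4 ^ p) := Nat.mul_le_mul_right _ hp1
      _ = _ := by rw [pow_add, pow_mul]; norm_num
  · have hr := Nat.ceil_lt_add_one h3.le
    have hlog : Real.log (4 * N + 1) ≤ 4 * lN := by
      have : 4 * lN = Real.log ((2 * N) ^ 4) := by rw [Real.log_pow]; norm_num [hlN]
      rw [this]
      apply Real.log_le_log (by linarith)
      have h4 : (N:ℝ) ≤ N ^ 4 := le_self_pow₀ hN' (by norm_num)
      rw [mul_pow]; linarith
    have hlog0 : 0 ≤ Real.log (4 * (N:ℝ) + 1) := Real.log_nonneg (by linarith)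
    have hJ : ((3 + 2 * p : ℕ) : ℝ) + 1 ≤ 11 * ls := by push_cast; linarith
    have hmain : (((3 + 2 * p : ℕ) : ℝ) + 1) ^ 2 * (2 * p * Real.log (4 * N + 1)) ≤
        (11 * ls) ^ 2 * (2 * (2.5 * ls) * (4 * lN)) := by gcongr
    have hlow : (0.69:ℝ) ^ 3 * 0.69 ≤ ls ^ 3 * lN := by gcongr
    have e : (11 * ls) ^ 2 * (2 * (2.5 * ls) * (4 * lN)) = 2420 * (ls ^ 3 * lN) := by ring
    rw [e] at hmain
    norm_num at hlow
    linarith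
/-- the sampling matrix of a bounded orthonormal system satisfies the RIP
for the sparse corruptions problem with high probability. -/
theorem bos_ripCor_whp :
    ∃ c : ℝ, 0 < c ∧
      ∀ (D : Type) [MeasurableSpace D] (ν : Measure D), IsProbabilityMeasure ν →
        ∀ (N m : ℕ) (φ : Fin N → D → ℂ) (K : ℝ), 0 < K →
          (∀ j, Measurable (φ j)) →
          (∀ i j, ∫ ξ, φ i ξ * (starRingEnd ℂ) (φ j ξ) ∂ν = if i = j then 1 else 0) →
          (∀ j ξ, ‖φ j ξ‖ ≤ K) →
          ∀ (s k : ℕ) (δ ε : ℝ), 1 ≤ s → s ≤ N → 1 ≤ k → k ≤ m →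
            0 < δ → δ < 1 → 0 < ε → ε < 1 →
            (m : ℝ) ≥ c * δ⁻¹ ^ 2 * K ^ 2 * s *
              (Real.log (2 * s) ^ 3 * Real.log (2 * N) + Real.log (1 / ε)) →
            (m : ℝ) ≥ 8 * δ⁻¹ ^ 2 * K ^ 2 * s * k →
            ENNReal.ofReal (1 - ε) ≤
              (Measure.pi fun _ : Fin m => ν)
                {t : Fin m → D | RIPCor
                  (Matrix.of fun i j => ((Real.sqrt (m : ℝ) : ℂ))⁻¹ * φ j (t i)) s k δ} := by
  refine ⟨864 * (72 * 294912) * 2500, by norm_num, ?_⟩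
  intro D _ ν hν N m φ K hK hφ ho hb s k δ ε hs hsN hk hkm hδ hδ1 hε hε1 hm1 hm2
  have hm : 1 ≤ m := hk.trans hkm
  have hm0 : (0:ℝ) < m := by exact_mod_cast hm
  obtain ⟨r, J, p, hr, hp, hsp, hJ, hrε, hL⟩ := param_bd s N hs hsN ε hε hε1
  obtain ⟨Z, hZm, hZ0, ⟨B, hB⟩, hZq, hZ⟩ :=
    moment_main ν (m := m) φ K hK hφ ho hb r J p s hm hr hp hs hsp hJ
  have hlog0 : 0 ≤ Real.log (4 * (N:ℝ) + 1) := Real.log_nonneg (by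
    have : (0:ℝ) ≤ N := by positivity
    linarith)
  have key := tail_bd (Measure.pi fun _ : Fin m => ν) Z hZm hZ0 B hB r hr _ δ ε (by positivity)
    hδ hδ1 hε ?_ hrε hZ
  · refine key.trans (measure_mono fun t ht => ?_)
    simp only [Set.mem_setOf_eq] at ht ⊢
    refine det_rip s k K δ hm hk hδ (fun i j => φ j (t i)) (fun i j => hb j (t i)) ?_ hm2
    intro x hx
    refine (net_rip hs hJ _ (Z t) (hZq t) x hx).trans ?_
    have : 0 ≤ ∑ j, ‖x j‖ ^ 2 := by positivity
    exact mul_le_mul_of_nonneg_right (by linarith) this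
  · rw [div_le_iff₀ hm0]
    set Q := Real.log (2 * s) ^ 3 * Real.log (2 * N) + Real.log (1 / ε)
    have h1 : δ ^ 2 / 216 * (864 * (72 * 294912) * 2500 * δ⁻¹ ^ 2 * K ^ 2 * s * Q) ≤
        δ ^ 2 / 216 * m := mul_le_mul_of_nonneg_left hm1 (by positivity)
    refine le_trans ?_ h1
    calc _ ≤ 4 * (72 * 294912 * s * K ^ 2 * (2500 * Q)) := by gcongr
      _ = _ := by field_simp; ring
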